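/- arXiv:1902.05617 — 2 statements merged into one kernel-verified Lean document; each statement's English description precedes it below -/
import Mathlib

section
/- Let π : K[A_d,B_d,X_d,Y_d] → K[A_d,B_d,X_d,Y_d] be the K-algebra homomorphism determined by π(a_i) = x_i, π(b_i) = y_i, π(x_i) = x_i, π(y_i) = y_i for i = 1,…,d. Then for every element f of C_{2d} the following are equivalent: (1) δ(f) = 0 and π(f) = 0; (2) f lies in L. In other words, the K[X_d,Y_d]^δ-submodule L consists exactly of all constants of δ in C_{2d} that are annihilated by the substitution a_i ↦ x_i, b_i ↦ y_i (the Lie elements of C_{2d}^δ). -/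
open MvPolynomial

noncomputable section

/-- The variables of `K[A_d,B_d,X_d,Y_d]`: `Sum.inl (Sum.inl i) = aᵢ`,
`Sum.inl (Sum.inr i) = bᵢ`, `Sum.inr (Sum.inl i) = xᵢ`, `Sum.inr (Sum.inr i) = yᵢ`. -/
abbrev Var4 (d : ℕ) : Type := (Fin d ⊕ Fin d) ⊕ (Fin d ⊕ Fin d)

variable (K : Type*) [Field K] (d : ℕ)

def aP (i : Fin d) : MvPolynomial (Var4 d) K := X (Sum.inl (Sum.inl i))
def bP (i : Fin d) : MvPolynomial (Var4 d) K := X (Sum.inl (Sum.inr i))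
def xP (i : Fin d) : MvPolynomial (Var4 d) K := X (Sum.inr (Sum.inl i))
def yP (i : Fin d) : MvPolynomial (Var4 d) K := X (Sum.inr (Sum.inr i))

/-- `u_{pq} = x_p y_q - x_q y_p`. -/
def uP (p q : Fin d) : MvPolynomial (Var4 d) K := xP K d p * yP K d q - xP K d q * yP K d p

/-- `w_{pq} = a_p y_q - b_p x_q`. -/
def wP (p q : Fin d) : MvPolynomial (Var4 d) K := aP K d p * yP K d q - bP K d p * xP K d q

/-- The canonical embedding of `K[X_d,Y_d]` into `K[A_d,B_d,X_d,Y_d]`. -/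
def embXY : MvPolynomial (Fin d ⊕ Fin d) K →ₐ[K] MvPolynomial (Var4 d) K := rename Sum.inr

/-- `C_{2d}`, the free `K[X_d,Y_d]`-module with basis `a₁,…,a_d,b₁,…,b_d`, viewed as a
subset of `K[A_d,B_d,X_d,Y_d]`. -/
def Cmod : Set (MvPolynomial (Var4 d) K) :=
  {f | ∃ F G : Fin d → MvPolynomial (Fin d ⊕ Fin d) K,
    f = ∑ i, aP K d i * embXY K d (F i) + ∑ i, bP K d i * embXY K d (G i)}

/-- The generators of the module `L`. -/
def Lgens : Set (MvPolynomial (Var4 d) K) :=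
  (Set.range fun i : Fin d => wP K d i i) ∪
  {g | ∃ i j : Fin d, i < j ∧ g = wP K d i j + wP K d j i} ∪
  {g | ∃ i j : Fin d, i < j ∧ g = aP K d i * xP K d j - aP K d j * xP K d i} ∪
  {g | ∃ i p q : Fin d, p < q ∧ g = aP K d i * uP K d p q - wP K d p q * xP K d i} ∪
  {g | ∃ i j k : Fin d, i < j ∧ j < k ∧
    g = aP K d i * uP K d j k - aP K d j * uP K d i k + aP K d k * uP K d i j} ∪
  {g | ∃ i j p q : Fin d, i < j ∧ p < q ∧
    g = wP K d i j * uP K d p q - wP K d p q * uP K d i j}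

/-- The `K[X_d,Y_d]^δ`-submodule `L` of `C_{2d}` generated by `Lgens`: the set of all
finite sums `Σ g·h` with `g ∈ Lgens` and `h` a constant of `δ` in (the image of)
`K[X_d,Y_d]`. -/
def Lsub (δ : Derivation K (MvPolynomial (Var4 d) K) (MvPolynomial (Var4 d) K)) :
    Submodule K (MvPolynomial (Var4 d) K) :=
  Submodule.span K {z | ∃ g ∈ Lgens K d, ∃ h : MvPolynomial (Fin d ⊕ Fin d) K,
    δ (embXY K d h) = 0 ∧ z = g * embXY K d h}


/-- The substitution homomorphism `π : K[A_d,B_d,X_d,Y_d] → K[A_d,B_d,X_d,Y_d]`,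
`aᵢ ↦ xᵢ`, `bᵢ ↦ yᵢ`, `xᵢ ↦ xᵢ`, `yᵢ ↦ yᵢ`. -/
def piSubst : MvPolynomial (Var4 d) K →ₐ[K] MvPolynomial (Var4 d) K :=
  aeval (fun v => match v with
    | Sum.inl (Sum.inl i) => xP K d i
    | Sum.inl (Sum.inr i) => yP K d i
    | Sum.inr (Sum.inl i) => xP K d i
    | Sum.inr (Sum.inr i) => yP K d i)

/-! ### The Weitzenböck derivation on `K[X_d,Y_d]` -/

/-- The partial derivative `∂/∂xᵢ` on `K[X_d,Y_d]`. -/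
abbrev derivX {K : Type*} [Field K] {d : ℕ} (i : Fin d) :
    Derivation K (MvPolynomial (Fin d ⊕ Fin d) K) (MvPolynomial (Fin d ⊕ Fin d) K) :=
  pderiv (Sum.inl i)

/-- The partial derivative `∂/∂yᵢ` on `K[X_d,Y_d]`. -/
abbrev derivY {K : Type*} [Field K] {d : ℕ} (i : Fin d) :
    Derivation K (MvPolynomial (Fin d ⊕ Fin d) K) (MvPolynomial (Fin d ⊕ Fin d) K) :=
  pderiv (Sum.inr i)

/-- The derivation `xᵢ ↦ 0`, `yᵢ ↦ xᵢ` of `K[X_d,Y_d]`. -/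
def weitz : Derivation K (MvPolynomial (Fin d ⊕ Fin d) K) (MvPolynomial (Fin d ⊕ Fin d) K) :=
  mkDerivation K (Sum.elim (fun _ => 0) (fun i => X (Sum.inl i)))

/-- The determinant `x_p y_q - x_q y_p` in `K[X_d,Y_d]`. -/
def detXY (p q : Fin d) : MvPolynomial (Fin d ⊕ Fin d) K :=
  X (Sum.inl p) * X (Sum.inr q) - X (Sum.inl q) * X (Sum.inr p)

/-- Cayley's operator `∂/∂xᵢ ∂/∂yⱼ - ∂/∂xⱼ ∂/∂yᵢ`. -/
def cayley {K : Type*} [Field K] {d : ℕ} (i j : Fin d) (p : MvPolynomial (Fin d ⊕ Fin d) K) :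
    MvPolynomial (Fin d ⊕ Fin d) K :=
  derivX i (derivY j p) - derivX j (derivY i p)

section Weitz

variable {K : Type*} [Field K] {d : ℕ}

local notation "P" => MvPolynomial (Fin d ⊕ Fin d) K

@[simp] lemma weitz_X_inl (i : Fin d) : weitz K d (X (Sum.inl i)) = 0 := by simp [weitz]

@[simp] lemma weitz_X_inr (i : Fin d) : weitz K d (X (Sum.inr i)) = X (Sum.inl i) := by
  simp [weitz]

lemma weitz_detXY (p q : Fin d) : weitz K d (detXY K d p q) = 0 := by
  simp [detXY, mul_comm]

lemma pderiv_comm {R σ : Type*} [CommRing R] (i j : σ) (p : MvPolynomial σ R) :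
    pderiv i (pderiv j p) = pderiv j (pderiv i p) := by
  classical
  have h : ⁅pderiv (R := R) i, pderiv (R := R) j⁆ = 0 := by
    refine derivation_ext fun k => ?_
    rw [Derivation.commutator_apply]
    simp only [pderiv_X, Pi.single_apply, Derivation.zero_apply]
    split_ifs <;> simp
  have := congrArg (fun D => D p) h
  simpa [Derivation.commutator_apply, sub_eq_zero] using this

lemma derivX_weitz (i : Fin d) (p : P) :
    derivX i (weitz K d p) = weitz K d (derivX i p) + derivY i p := by
  classical
  have h : ⁅derivX (K := K) i, weitz K d⁆ = derivY (K := K) i := by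
    refine derivation_ext fun k => ?_
    rw [Derivation.commutator_apply]
    rcases k with k | k <;>
    simp only [pderiv_X, Pi.single_apply, weitz_X_inl, weitz_X_inr] <;> split_ifs <;> simp_all
  have := congrArg (fun D => D p) h
  rw [← this, Derivation.commutator_apply]
  ring

lemma derivY_weitz (i : Fin d) (p : P) :
    derivY i (weitz K d p) = weitz K d (derivY i p) := by
  classical
  have h : ⁅derivY (K := K) i, weitz K d⁆ = 0 := by
    refine derivation_ext fun k => ?_
    rw [Derivation.commutator_apply]
    rcases k with k | k <;>
    simp only [pderiv_X, Pi.single_apply, weitz_X_inl, weitz_X_inr] <;> split_ifs <;> simp_all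
  have := congrArg (fun D => D p) h
  simpa [Derivation.commutator_apply, sub_eq_zero] using this

lemma weitz_apply (p : P) : weitz K d p = ∑ i, X (Sum.inl i) * derivY i p := by
  classical
  have hsum (q : P) :
      (∑ i, (X (Sum.inl i) : P) • derivY i) q = ∑ i, X (Sum.inl i) * derivY i q := by
    have := map_sum (Derivation.coeFnAddMonoidHom (R := K) (A := P) (M := P))
      (fun i => (X (Sum.inl i) : P) • derivY i) Finset.univ
    exact (congrFun this q).trans (Finset.sum_apply _ _ _)
  have h : weitz K d = ∑ i, (X (Sum.inl i) : P) • derivY i := by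
    refine derivation_ext fun k => ?_
    rw [hsum]
    rcases k with k | k <;> simp [pderiv_X, Pi.single_apply]
  rw [h, hsum]

lemma weitz_cayley (i j : Fin d) (p : P) :
    weitz K d (cayley i j p) = cayley i j (weitz K d p) := by
  simp only [cayley, map_sub, derivY_weitz, derivX_weitz, pderiv_comm (Sum.inr i) (Sum.inr j)]
  ring

/-- Capelli's identity for two rows. -/
lemma sum_detXY_mul_cayley (p : P) :
    ∑ i, ∑ j, detXY K d i j * cayley i j p =
      2 * (∑ i, X (Sum.inl i) * derivX i (∑ j, X (Sum.inr j) * derivY j p) +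
        ∑ j, X (Sum.inr j) * derivY j p -
        ∑ j, X (Sum.inr j) * derivX j (weitz K d p)) := by
  have h1 (i : Fin d) : derivX i (∑ j, X (Sum.inr j) * derivY j p) =
      ∑ j, X (Sum.inr j) * derivX i (derivY j p) := by
    simp [map_sum, Derivation.leibniz]
  have h2 (j : Fin d) : derivX j (weitz K d p) =
      ∑ i, X (Sum.inl i) * derivX j (derivY i p) + derivY j p := by
    rw [derivX_weitz, weitz_apply]
    simp only [pderiv_comm (Sum.inl j)]
  simp only [h1, h2, mul_add, Finset.sum_add_distrib, Finset.mul_sum]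
  have h3 : ∑ j : Fin d, ∑ i : Fin d,
      (X (Sum.inr j) * (X (Sum.inl i) * derivX j (derivY i p)) : P) =
      ∑ i : Fin d, ∑ j : Fin d, X (Sum.inr j) * (X (Sum.inl i) * derivX j (derivY i p)) :=
    Finset.sum_comm
  have h4 : ∑ i : Fin d, ∑ j : Fin d, (X (Sum.inl j) * X (Sum.inr i) * cayley i j p : P) =
      - ∑ i : Fin d, ∑ j : Fin d, X (Sum.inl i) * X (Sum.inr j) * cayley i j p := by
    rw [Finset.sum_comm, ← Finset.sum_neg_distrib]
    refine Finset.sum_congr rfl fun i _ => ?_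
    rw [← Finset.sum_neg_distrib]
    refine Finset.sum_congr rfl fun j _ => ?_
    simp only [cayley]; ring
  have h5 : ∑ i : Fin d, ∑ j : Fin d, (X (Sum.inl i) * X (Sum.inr j) * cayley i j p : P) =
      ∑ i : Fin d, ∑ j : Fin d, X (Sum.inl i) * (X (Sum.inr j) * derivX i (derivY j p)) -
      ∑ i : Fin d, ∑ j : Fin d, X (Sum.inr j) * (X (Sum.inl i) * derivX j (derivY i p)) := by
    rw [← Finset.sum_sub_distrib]
    refine Finset.sum_congr rfl fun i _ => ?_
    rw [← Finset.sum_sub_distrib]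
    refine Finset.sum_congr rfl fun j _ => ?_
    simp only [cayley]; ring
  simp only [detXY, sub_mul, Finset.sum_sub_distrib, h4, h5, h3]
  ring

/-! ### The bigrading by degrees in `x` and `y` -/

/-- The weight giving the bidegree in `(x, y)`. -/
def biweight (d : ℕ) : Fin d ⊕ Fin d → ℤ × ℤ := Sum.elim (fun _ => (1, 0)) (fun _ => (0, 1))

lemma weight_biweight (s : Fin d ⊕ Fin d →₀ ℕ) :
    Finsupp.weight (biweight d) s =
      (((∑ i, s (Sum.inl i) : ℕ) : ℤ), ((∑ i, s (Sum.inr i) : ℕ) : ℤ)) := by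
  rw [Finsupp.weight_apply, Finsupp.sum_fintype _ _ (by simp), Fintype.sum_sum_type]
  ext <;> simp [biweight, Prod.fst_sum, Prod.snd_sum]

lemma MvPolynomial.IsWeightedHomogeneous.eq_zero_or_nonneg {p : P} {n m : ℤ}
    (h : IsWeightedHomogeneous (biweight d) p (n, m)) : p = 0 ∨ 0 ≤ n ∧ 0 ≤ m := by
  rcases eq_or_ne p 0 with hp | hp
  · exact Or.inl hp
  · obtain ⟨s, hs⟩ := exists_coeff_ne_zero hp
    have := h hs
    rw [weight_biweight, Prod.mk.injEq] at this
    right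
    constructor
    · rw [← this.1]; positivity
    · rw [← this.2]; positivity

lemma coeff_X_mul_pderiv {R σ : Type*} [CommRing R] (i : σ) (p : MvPolynomial σ R)
    (s : σ →₀ ℕ) : coeff s (X i * pderiv i p) = s i * coeff s p := by
  classical
  induction p using MvPolynomial.induction_on' with
  | add p q hp hq => simp [mul_add, hp, hq]
  | monomial n a =>
    rw [X_mul_pderiv_monomial, coeff_smul, coeff_monomial]
    split_ifs with h <;> simp [h]

lemma MvPolynomial.IsWeightedHomogeneous.sum_X_mul_derivX {p : P} {n m : ℤ}
    (h : IsWeightedHomogeneous (biweight d) p (n, m)) :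
    ∑ i, X (Sum.inl i) * derivX i p = (n : P) * p := by
  ext s
  have hC : (n : P) = C (n : K) := by simp
  rw [coeff_sum, hC, coeff_C_mul]
  simp only [coeff_X_mul_pderiv]
  rw [← Finset.sum_mul]
  by_cases hs : coeff s p = 0
  · simp [hs]
  · have := h hs
    rw [weight_biweight, Prod.mk.injEq] at this
    rw [← this.1]; simp

lemma MvPolynomial.IsWeightedHomogeneous.sum_X_mul_derivY {p : P} {n m : ℤ}
    (h : IsWeightedHomogeneous (biweight d) p (n, m)) :
    ∑ i, X (Sum.inr i) * derivY i p = (m : P) * p := by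
  ext s
  have hC : (m : P) = C (m : K) := by simp
  rw [coeff_sum, hC, coeff_C_mul]
  simp only [coeff_X_mul_pderiv]
  rw [← Finset.sum_mul]
  by_cases hs : coeff s p = 0
  · simp [hs]
  · have := h hs
    rw [weight_biweight, Prod.mk.injEq] at this
    rw [← this.2]; simp

lemma MvPolynomial.IsWeightedHomogeneous.map_derivX {p : P} {w : ℤ × ℤ} (i : Fin d)
    (h : IsWeightedHomogeneous (biweight d) p w) :
    IsWeightedHomogeneous (biweight d) (derivX i p) (w + (-1, 0)) :=
  IsWeightedHomogeneous.pderiv h (by ext <;> simp [biweight])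

lemma MvPolynomial.IsWeightedHomogeneous.map_derivY {p : P} {w : ℤ × ℤ} (i : Fin d)
    (h : IsWeightedHomogeneous (biweight d) p w) :
    IsWeightedHomogeneous (biweight d) (derivY i p) (w + (0, -1)) :=
  IsWeightedHomogeneous.pderiv h (by ext <;> simp [biweight])

lemma MvPolynomial.IsWeightedHomogeneous.X_inl_mul {p : P} {w : ℤ × ℤ} (i : Fin d)
    (h : IsWeightedHomogeneous (biweight d) p w) :
    IsWeightedHomogeneous (biweight d) (X (Sum.inl i) * p) (w + (1, 0)) := by
  rw [add_comm]
  exact (isWeightedHomogeneous_X K (biweight d) (Sum.inl i)).mul h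

lemma MvPolynomial.IsWeightedHomogeneous.X_inr_mul {p : P} {w : ℤ × ℤ} (i : Fin d)
    (h : IsWeightedHomogeneous (biweight d) p w) :
    IsWeightedHomogeneous (biweight d) (X (Sum.inr i) * p) (w + (0, 1)) := by
  rw [add_comm]
  exact (isWeightedHomogeneous_X K (biweight d) (Sum.inr i)).mul h

lemma MvPolynomial.IsWeightedHomogeneous.map_weitz {p : P} {w : ℤ × ℤ}
    (h : IsWeightedHomogeneous (biweight d) p w) :
    IsWeightedHomogeneous (biweight d) (weitz K d p) (w + (1, -1)) := by
  rw [weitz_apply]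
  refine IsWeightedHomogeneous.sum _ _ _ fun i _ => ?_
  convert! (h.map_derivY i).X_inl_mul i using 1
  rw [add_assoc]; rfl

lemma MvPolynomial.IsWeightedHomogeneous.map_cayley {p : P} {w : ℤ × ℤ} (i j : Fin d)
    (h : IsWeightedHomogeneous (biweight d) p w) :
    IsWeightedHomogeneous (biweight d) (cayley i j p) (w + (-1, -1)) := by
  refine IsWeightedHomogeneous.sub ?_ ?_
  · convert! (h.map_derivY j).map_derivX i using 1
    rw [add_assoc]; rfl
  · convert! (h.map_derivY i).map_derivX j using 1
    rw [add_assoc]; rfl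

/-- A linear map that shifts weights by a constant commutes with taking components. -/
lemma weightedHomogeneousComponent_map {R σ M : Type*} [CommRing R] [AddCommGroup M]
    {wt : σ → M} (c : M) (T : MvPolynomial σ R →ₗ[R] MvPolynomial σ R)
    (hT : ∀ p w, IsWeightedHomogeneous wt p w → IsWeightedHomogeneous wt (T p) (w + c))
    (w : M) (p : MvPolynomial σ R) :
    weightedHomogeneousComponent wt (w + c) (T p) = T (weightedHomogeneousComponent wt w p) := by
  classical
  induction p using MvPolynomial.induction_on' with
  | add p q hp hq => simp only [map_add, hp, hq]
  | monomial s a =>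
    have h := isWeightedHomogeneous_monomial wt s a rfl
    rw [weightedHomogeneousComponent_of_mem (hT _ _ h), weightedHomogeneousComponent_of_mem h]
    simp only [add_left_inj]
    split_ifs <;> simp

lemma weightedHomogeneousComponent_weitz (w : ℤ × ℤ) (p : P) :
    weightedHomogeneousComponent (biweight d) (w + (1, -1)) (weitz K d p) =
      weitz K d (weightedHomogeneousComponent (biweight d) w p) :=
  weightedHomogeneousComponent_map _ (weitz K d).toLinearMap (fun _ _ h => h.map_weitz) w p

lemma weightedHomogeneousComponent_X_inl_mul (i : Fin d) (w : ℤ × ℤ) (p : P) :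
    weightedHomogeneousComponent (biweight d) (w + (1, 0)) (X (Sum.inl i) * p) =
      X (Sum.inl i) * weightedHomogeneousComponent (biweight d) w p :=
  weightedHomogeneousComponent_map _ (LinearMap.mulLeft K (X (Sum.inl i)))
    (fun _ _ h => h.X_inl_mul i) w p

lemma weightedHomogeneousComponent_X_inr_mul (i : Fin d) (w : ℤ × ℤ) (p : P) :
    weightedHomogeneousComponent (biweight d) (w + (0, 1)) (X (Sum.inr i) * p) =
      X (Sum.inr i) * weightedHomogeneousComponent (biweight d) w p :=
  weightedHomogeneousComponent_map _ (LinearMap.mulLeft K (X (Sum.inr i)))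
    (fun _ _ h => h.X_inr_mul i) w p

/-- A finite family of polynomials is a common finite sum of bihomogeneous components. -/
lemma exists_finset_sum_components {ι : Type*} [Fintype ι] (F : ι → P) :
    ∃ S : Finset (ℤ × ℤ),
      ∀ k, F k = ∑ w ∈ S, weightedHomogeneousComponent (biweight d) w (F k) := by
  classical
  refine ⟨Finset.univ.biUnion fun k => (F k).support.image (Finsupp.weight (biweight d)),
    fun k => ?_⟩
  ext s
  rw [coeff_sum]
  simp only [coeff_weightedHomogeneousComponent, Finset.sum_ite_eq]
  split_ifs with h
  · rfl
  · by_contra hs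
    exact h (Finset.mem_biUnion.2 ⟨k, Finset.mem_univ _,
      Finset.mem_image_of_mem _ (mem_support_iff.2 hs)⟩)

end Weitz

section Lie

variable {K : Type*} [Field K] {d : ℕ}

local notation "P" => MvPolynomial (Fin d ⊕ Fin d) K
local notation "Q" => MvPolynomial (Var4 d) K

/-! ### Constants of `C_{2d}` -/

@[simp] lemma embXY_X_inl (i : Fin d) : embXY K d (X (Sum.inl i)) = xP K d i := by
  simp [embXY, xP]

@[simp] lemma embXY_X_inr (i : Fin d) : embXY K d (X (Sum.inr i)) = yP K d i := by
  simp [embXY, yP]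

@[simp] lemma embXY_detXY (i j : Fin d) : embXY K d (detXY K d i j) = uP K d i j := by
  simp [detXY, uP]

lemma embXY_injective : Function.Injective (embXY K d) :=
  rename_injective _ Sum.inr_injective

@[simp] lemma piSubst_aP (i : Fin d) : piSubst K d (aP K d i) = xP K d i := by
  simp [piSubst, aP]

@[simp] lemma piSubst_bP (i : Fin d) : piSubst K d (bP K d i) = yP K d i := by
  simp [piSubst, bP]

@[simp] lemma piSubst_xP (i : Fin d) : piSubst K d (xP K d i) = xP K d i := by
  conv_lhs => rw [xP]
  simp [piSubst]

@[simp] lemma piSubst_yP (i : Fin d) : piSubst K d (yP K d i) = yP K d i := by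
  conv_lhs => rw [yP]
  simp [piSubst]

@[simp] lemma piSubst_embXY (p : P) : piSubst K d (embXY K d p) = embXY K d p := by
  have h : (piSubst K d).comp (embXY K d) = embXY K d := by
    refine algHom_ext fun k => ?_
    rcases k with k | k <;> simp
  exact congrArg (fun φ => φ p) h

@[simp] lemma piSubst_wP (i j : Fin d) : piSubst K d (wP K d i j) = uP K d i j := by
  simp [uP, wP, mul_comm]

/-- The element `∑ aₖ Fₖ - ∑ bₖ δ(Fₖ)` of `C_{2d}`; every constant of `C_{2d}` is of this form. -/
def constOf (F : Fin d → P) : Q :=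
  ∑ k, aP K d k * embXY K d (F k) - ∑ k, bP K d k * embXY K d (weitz K d (F k))

lemma constOf_sum {ι : Type*} (s : Finset ι) (F : ι → Fin d → P) :
    constOf (fun k => ∑ i ∈ s, F i k) = ∑ i ∈ s, constOf (F i) := by
  simp only [constOf, map_sum, Finset.mul_sum, Finset.sum_sub_distrib]
  rw [Finset.sum_comm (s := s), Finset.sum_comm (s := s)]

lemma constOf_add (F G : Fin d → P) :
    constOf (fun k => F k + G k) = constOf F + constOf G := by
  simp only [constOf, map_add, mul_add, Finset.sum_add_distrib]
  ring

lemma constOf_mul {h : P} (hh : weitz K d h = 0) (F : Fin d → P) :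
    constOf (fun k => h * F k) = embXY K d h * constOf F := by
  simp only [constOf, Derivation.leibniz, hh, smul_eq_mul, mul_zero, add_zero, map_mul, mul_sub,
    Finset.mul_sum, mul_left_comm]

lemma constOf_C_mul (c : K) (F : Fin d → P) :
    constOf (fun k => C c * F k) = c • constOf F := by
  rw [constOf_mul (derivation_C _ _), embXY, rename_C, ← smul_eq_C_mul]

lemma piSubst_constOf (F : Fin d → P) :
    piSubst K d (constOf F) = embXY K d
      (∑ k, X (Sum.inl k) * F k - ∑ k, X (Sum.inr k) * weitz K d (F k)) := by
  simp [constOf]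

lemma sum_wP_mul {h : Fin d → Fin d → P} (hh : ∀ i j, weitz K d (h i j) = 0) :
    ∑ i, ∑ j, wP K d i j * embXY K d (h i j) =
      constOf (fun k => ∑ j, X (Sum.inr j) * h k j) := by
  simp only [constOf, map_sum, Derivation.leibniz, hh, smul_eq_mul, mul_zero, zero_add,
    weitz_X_inr, map_mul, embXY_X_inl, embXY_X_inr, wP, sub_mul, Finset.sum_sub_distrib,
    Finset.mul_sum, mul_assoc, mul_comm (embXY K d (h _ _))]

/-- The constant `(∂/∂aᵢ ∂/∂yⱼ - ∂/∂xⱼ ∂/∂bᵢ) f` for `f = constOf F`. -/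
def mixed (F : Fin d → P) (i j : Fin d) : P :=
  derivY j (F i) + derivX j (weitz K d (F i))

lemma weitz_mixed {F : Fin d → P} (hF : ∀ k, weitz K d (weitz K d (F k)) = 0) (i j : Fin d) :
    weitz K d (mixed F i j) = 0 := by
  have h := derivX_weitz j (weitz K d (F i))
  rw [hF, map_zero, derivY_weitz] at h
  rw [mixed, map_add, h]
  ring

/-- Capelli's identity on the bihomogeneous constants of `C_{2d}`. -/
lemma capelli_constOf {F : Fin d → P} {n m : ℤ}
    (hF : ∀ k, IsWeightedHomogeneous (biweight d) (F k) (n, m))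
    (hδ : ∀ k, weitz K d (weitz K d (F k)) = 0) :
    ((2 * m * (n + 2) : ℤ) : K) • constOf F =
      ∑ i, ∑ j, uP K d i j * constOf (fun k => cayley i j (F k)) +
        2 * ∑ i, ∑ j, wP K d i j * embXY K d (mixed F i j) := by
  have key (k : Fin d) : C ((2 * m * (n + 2) : ℤ) : K) * F k =
      ∑ i, ∑ j, detXY K d i j * cayley i j (F k) +
        2 * ∑ j, X (Sum.inr j) * mixed F k j := by
    have h1 : ∑ j, X (Sum.inr j) * mixed F k j = (m : P) * F k +
        ∑ j, X (Sum.inr j) * derivX j (weitz K d (F k)) := by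
      simp only [mixed, mul_add, Finset.sum_add_distrib, (hF k).sum_X_mul_derivY]
    have h2 (i : Fin d) : derivX i ((m : P) * F k) = (m : P) * derivX i (F k) := by
      have : (m : P) = C (m : K) := by simp
      rw [this, pderiv_C_mul]
    rw [sum_detXY_mul_cayley, h1, (hF k).sum_X_mul_derivY]
    simp only [h2, mul_left_comm _ (m : P)]
    rw [← Finset.mul_sum, (hF k).sum_X_mul_derivX]
    simp only [map_intCast]
    push_cast
    ring
  rw [← constOf_C_mul]
  simp only [key, constOf_add, constOf_sum]
  congr 1
  · simp only [constOf_mul (weitz_detXY _ _), embXY_detXY]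
  · rw [sum_wP_mul (weitz_mixed hδ), two_mul, ← constOf_add]
    simp only [two_mul]

/-- The constants `constOf F` lie in every `K[X_d,Y_d]^δ`-module containing all `aₖ` and
`w_{pq}`. -/
lemma constOf_mem [CharZero K] (S : Submodule K Q)
    (hS : ∀ z ∈ S, ∀ h, weitz K d h = 0 → z * embXY K d h ∈ S)
    (haS : ∀ k, aP K d k ∈ S) (hwS : ∀ p q, wP K d p q ∈ S) (m : ℕ) :
    ∀ (n : ℤ) (F : Fin d → P),
      (∀ k, IsWeightedHomogeneous (biweight d) (F k) (n, (m : ℤ))) →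
      (∀ k, weitz K d (weitz K d (F k)) = 0) → constOf F ∈ S := by
  induction m with
  | zero =>
    intro n F hF _
    have h0 (k : Fin d) : weitz K d (F k) = 0 := by
      rcases (hF k).map_weitz.eq_zero_or_nonneg with h | h
      · exact h
      · simp at h
    simp only [constOf, h0, map_zero, mul_zero, Finset.sum_const_zero, sub_zero]
    exact S.sum_mem fun k _ => hS _ (haS k) _ (h0 k)
  | succ m ih =>
    intro n F hF hδ
    by_cases hn : 0 ≤ n
    · have hc : ((2 * ((m + 1 : ℕ) : ℤ) * (n + 2) : ℤ) : K) ≠ 0 := by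
        rw [Int.cast_ne_zero]
        positivity
      rw [← S.smul_mem_iff hc, capelli_constOf hF hδ, two_mul (Finset.sum _ _)]
      have hw : ∑ i, ∑ j, wP K d i j * embXY K d (mixed F i j) ∈ S :=
        S.sum_mem fun i _ => S.sum_mem fun j _ => hS _ (hwS i j) _ (weitz_mixed hδ i j)
      refine S.add_mem (S.sum_mem fun i _ => S.sum_mem fun j _ => ?_) (S.add_mem hw hw)
      rw [mul_comm, ← embXY_detXY]
      refine hS _ (ih (n - 1) _ (fun k => ?_) fun k => ?_) _ (weitz_detXY i j)
      · convert! (hF k).map_cayley i j using 1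
        ext <;> simp [sub_eq_add_neg]
      · rw [weitz_cayley, weitz_cayley, hδ]
        simp [cayley]
    · have h0 (k : Fin d) : F k = 0 := (hF k).eq_zero_or_nonneg.resolve_right (by tauto)
      simp [constOf, h0]

/-! ### The module `L` -/

section Lsub

variable {δ : Derivation K (MvPolynomial (Var4 d) K) (MvPolynomial (Var4 d) K)}

lemma derivation_embXY (hx : ∀ i : Fin d, δ (xP K d i) = 0)
    (hy : ∀ i : Fin d, δ (yP K d i) = xP K d i) (p : P) :
    δ (embXY K d p) = embXY K d (weitz K d p) := by
  induction p using MvPolynomial.induction_on with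
  | C a => simp [embXY]
  | add p q hp hq => simp [hp, hq]
  | mul_X p i hp => rcases i with i | i <;> simp [hp, hx, hy]

lemma mul_mem_Lsub (hδ : ∀ p : P, δ (embXY K d p) = embXY K d (weitz K d p))
    {z : Q} (hz : z ∈ Lsub K d δ) {h : P} (hh : weitz K d h = 0) :
    z * embXY K d h ∈ Lsub K d δ := by
  induction hz using Submodule.span_induction with
  | mem z hz =>
    obtain ⟨g, hg, h', hh', rfl⟩ := hz
    refine Submodule.subset_span ⟨g, hg, h' * h, ?_, by rw [map_mul, mul_assoc]⟩
    rw [map_mul, Derivation.leibniz, hh', hδ h, hh]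
    simp
  | zero => simp
  | add y z _ _ hy hz => rw [add_mul]; exact Submodule.add_mem _ hy hz
  | smul c z _ hz => rw [smul_mul_assoc]; exact Submodule.smul_mem _ c hz

lemma mem_Lsub_of_mem_Lgens {g : Q} (hg : g ∈ Lgens K d) : g ∈ Lsub K d δ :=
  Submodule.subset_span ⟨g, hg, 1, by simp, by simp⟩

lemma wP_self_mem (i : Fin d) : wP K d i i ∈ Lsub K d δ :=
  mem_Lsub_of_mem_Lgens (by simp [Lgens])

lemma wP_add_wP_mem (i j : Fin d) : wP K d i j + wP K d j i ∈ Lsub K d δ := by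
  rcases lt_trichotomy i j with h | rfl | h
  · refine mem_Lsub_of_mem_Lgens ?_
    exact .inl <| .inl <| .inl <| .inl <| .inr ⟨i, j, h, rfl⟩
  · exact Submodule.add_mem _ (wP_self_mem i) (wP_self_mem i)
  · rw [add_comm]
    refine mem_Lsub_of_mem_Lgens ?_
    exact .inl <| .inl <| .inl <| .inl <| .inr ⟨j, i, h, rfl⟩

lemma aP_mul_xP_sub_mem (i j : Fin d) :
    aP K d i * xP K d j - aP K d j * xP K d i ∈ Lsub K d δ := by
  rcases lt_trichotomy i j with h | rfl | h
  · refine mem_Lsub_of_mem_Lgens ?_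
    exact .inl <| .inl <| .inl <| .inr ⟨i, j, h, rfl⟩
  · simp
  · rw [← Submodule.neg_mem_iff, neg_sub]
    refine mem_Lsub_of_mem_Lgens ?_
    exact .inl <| .inl <| .inl <| .inr ⟨j, i, h, rfl⟩

lemma uP_swap (i j : Fin d) : uP K d i j = -uP K d j i := by simp [uP]

lemma uP_self (i : Fin d) : uP K d i i = 0 := by simp [uP]

lemma wP_mul_mem (hδ : ∀ p : P, δ (embXY K d p) = embXY K d (weitz K d p)) (i j : Fin d)
    {h : P} (hh : weitz K d h = 0) {z : Q}
    (hz : z + wP K d j i * embXY K d h ∈ Lsub K d δ) :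
    z - wP K d i j * embXY K d h ∈ Lsub K d δ := by
  have := Submodule.sub_mem _ hz (mul_mem_Lsub hδ (wP_add_wP_mem (δ := δ) i j) hh)
  convert! this using 1
  ring

lemma aP_mul_uP_sub_mem (hδ : ∀ p : P, δ (embXY K d p) = embXY K d (weitz K d p))
    (i p q : Fin d) : uP K d p q * aP K d i - wP K d p q * xP K d i ∈ Lsub K d δ := by
  have hlt {p q : Fin d} (h : p < q) :
      uP K d p q * aP K d i - wP K d p q * xP K d i ∈ Lsub K d δ := by
    rw [mul_comm (uP K d p q)]
    exact mem_Lsub_of_mem_Lgens (.inl <| .inl <| .inr ⟨i, p, q, h, rfl⟩)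
  rw [← embXY_X_inl]
  rcases lt_trichotomy p q with h | rfl | h
  · simpa using hlt h
  · rw [uP_self, zero_mul, zero_sub]
    exact Submodule.neg_mem _ (mul_mem_Lsub hδ (wP_self_mem p) (weitz_X_inl i))
  · refine wP_mul_mem hδ p q (weitz_X_inl i) ?_
    rw [← Submodule.neg_mem_iff, uP_swap]
    convert! hlt h using 1
    rw [embXY_X_inl]; ring

lemma wP_mul_uP_sub_mem (hδ : ∀ p : P, δ (embXY K d p) = embXY K d (weitz K d p))
    (i j p q : Fin d) :
    uP K d i j * wP K d p q - wP K d i j * uP K d p q ∈ Lsub K d δ := by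
  have hlt {i j p q : Fin d} (h : i < j) (h' : p < q) :
      uP K d i j * wP K d p q - wP K d i j * uP K d p q ∈ Lsub K d δ := by
    rw [mul_comm (uP K d i j)]
    exact mem_Lsub_of_mem_Lgens (.inr ⟨p, q, i, j, h', h, rfl⟩)
  have hlt' {i j : Fin d} (p q : Fin d) (h : i < j) :
      uP K d i j * wP K d p q - wP K d i j * uP K d p q ∈ Lsub K d δ := by
    rcases lt_trichotomy p q with h' | rfl | h'
    · exact hlt h h'
    · rw [uP_self, mul_zero, sub_zero, mul_comm, ← embXY_detXY]
      exact mul_mem_Lsub hδ (wP_self_mem p) (weitz_detXY i j)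
    · have h2 := Submodule.sub_mem _
        (mul_mem_Lsub hδ (wP_add_wP_mem (δ := δ) p q) (weitz_detXY i j)) (hlt h h')
      convert! h2 using 1
      rw [embXY_detXY, uP_swap p q]; ring
  rcases lt_trichotomy i j with h | rfl | h
  · exact hlt' p q h
  · rw [uP_self, zero_mul, zero_sub, ← embXY_detXY]
    exact Submodule.neg_mem _ (mul_mem_Lsub hδ (wP_self_mem i) (weitz_detXY p q))
  · rw [← embXY_detXY p q]
    refine wP_mul_mem hδ i j (weitz_detXY p q) ?_
    rw [← Submodule.neg_mem_iff, uP_swap]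
    convert! hlt' p q h using 1
    rw [embXY_detXY]; ring

lemma uP_mul_constOf_sub_mem [CharZero K]
    (hδ : ∀ p : P, δ (embXY K d p) = embXY K d (weitz K d p)) (i j : Fin d)
    {n m : ℤ} {F : Fin d → P}
    (hF : ∀ k, IsWeightedHomogeneous (biweight d) (F k) (n, m))
    (hE : ∀ k, weitz K d (weitz K d (F k)) = 0) :
    uP K d i j * constOf F - wP K d i j * piSubst K d (constOf F) ∈ Lsub K d δ := by
  by_cases hm : 0 ≤ m
  · lift m to ℕ using hm
    refine constOf_mem ((Lsub K d δ).comap (LinearMap.mulLeft K (uP K d i j) -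
      LinearMap.mulLeft K (wP K d i j) ∘ₗ (piSubst K d).toLinearMap))
      (fun z hz h hh => ?_) (fun k => ?_) (fun p q => ?_) m n F hF hE
    · have := mul_mem_Lsub hδ hz hh
      simp only [Submodule.mem_comap, LinearMap.sub_apply, LinearMap.mulLeft_apply,
        LinearMap.comp_apply, AlgHom.toLinearMap_apply, map_mul, piSubst_embXY] at this ⊢
      convert! this using 1
      ring
    · simpa using aP_mul_uP_sub_mem hδ k i j
    · simpa using wP_mul_uP_sub_mem hδ i j p q
  · have h0 (k : Fin d) : F k = 0 := (hF k).eq_zero_or_nonneg.resolve_right (by tauto)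
    simp [constOf, h0]

lemma piSubst_constOf_cayley {F : Fin d → P}
    (hπ : ∑ k, X (Sum.inl k) * F k - ∑ k, X (Sum.inr k) * weitz K d (F k) = 0) (i j : Fin d) :
    piSubst K d (constOf fun k => cayley i j (F k)) =
      embXY K d (mixed F j i) - embXY K d (mixed F i j) := by
  classical
  have hx (i j : Fin d) (G : Fin d → P) : cayley i j (∑ k, X (Sum.inl k) * G k) =
      ∑ k, X (Sum.inl k) * cayley i j (G k) + derivY j (G i) - derivY i (G j) := by
    simp [cayley, Derivation.leibniz, pderiv_X, Pi.single_apply, mul_sub,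
      Finset.sum_add_distrib]
    ring
  have hy (i j : Fin d) (G : Fin d → P) : cayley i j (∑ k, X (Sum.inr k) * G k) =
      ∑ k, X (Sum.inr k) * cayley i j (G k) + derivX i (G j) - derivX j (G i) := by
    simp [cayley, Derivation.leibniz, pderiv_X, Pi.single_apply, mul_sub,
      Finset.sum_add_distrib]
    ring
  have h := congrArg (cayley i j) hπ
  have hsub (p q : P) : cayley i j (p - q) = cayley i j p - cayley i j q := by
    simp only [cayley, map_sub]; ring
  rw [hsub, hx, hy] at h
  rw [piSubst_constOf, ← map_sub]
  congr 1
  simp only [weitz_cayley, mixed]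
  have h0 : cayley i j (0 : P) = 0 := by simp [cayley]
  rw [h0] at h
  linear_combination h

lemma constOf_mem_Lsub_of_homogeneous [CharZero K]
    (hδ : ∀ p : P, δ (embXY K d p) = embXY K d (weitz K d p)) {n m : ℕ} {F : Fin d → P}
    (hF : ∀ k, IsWeightedHomogeneous (biweight d) (F k) ((n : ℤ), (m : ℤ)))
    (hE : ∀ k, weitz K d (weitz K d (F k)) = 0)
    (hπ : ∑ k, X (Sum.inl k) * F k - ∑ k, X (Sum.inr k) * weitz K d (F k) = 0) :
    constOf F ∈ Lsub K d δ := by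
  classical
  rcases Nat.eq_zero_or_pos m with rfl | hm
  · have h0 (k : Fin d) : weitz K d (F k) = 0 := by
      rcases (hF k).map_weitz.eq_zero_or_nonneg with h | h
      · exact h
      · simp at h
    have h1 (j k : Fin d) : derivY j (F k) = 0 := by
      rcases ((hF k).map_derivY j).eq_zero_or_nonneg with h | h
      · exact h
      · simp at h
    have hH (i j : Fin d) : weitz K d (derivX i (F j) - derivX j (F i)) = 0 := by
      have h2 (i j : Fin d) : weitz K d (derivX i (F j)) = 0 := by
        have := derivX_weitz i (F j)
        rw [h0, map_zero, h1, add_zero] at this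
        exact this.symm
      rw [map_sub, h2, h2, sub_zero]
    have key (j : Fin d) : C ((n : K) + 1) * F j =
        ∑ i, X (Sum.inl i) * (derivX i (F j) - derivX j (F i)) := by
      simp only [h0, mul_zero, Finset.sum_const_zero, sub_zero] at hπ
      have h := congrArg (derivX j) hπ
      simp only [map_sum, Derivation.leibniz, smul_eq_mul, map_zero, Finset.sum_add_distrib,
        pderiv_X, Pi.single_apply, Sum.inl.injEq, mul_ite, mul_one, mul_zero,
        Finset.sum_ite_eq', Finset.mem_univ, if_true] at h
      simp only [mul_sub, Finset.sum_sub_distrib, (hF j).sum_X_mul_derivX]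
      simp only [map_add, map_natCast, map_one, Int.cast_natCast]
      linear_combination h
    have hsum : (2 * ((n : K) + 1)) • constOf F =
        ∑ i, ∑ j, (aP K d j * xP K d i - aP K d i * xP K d j) *
          embXY K d (derivX i (F j) - derivX j (F i)) := by
      have e1 : ((n : K) + 1) • constOf F = ∑ i, ∑ j, aP K d j * xP K d i *
          embXY K d (derivX i (F j) - derivX j (F i)) := by
        have h2 (k : Fin d) : weitz K d (C ((n : K) + 1) * F k) = 0 := by
          rw [Derivation.leibniz, h0, derivation_C, smul_zero, smul_zero, add_zero]
        rw [← constOf_C_mul, Finset.sum_comm]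
        simp only [constOf, h2, map_zero, mul_zero, Finset.sum_const_zero, sub_zero]
        simp only [key, map_sum, map_mul, embXY_X_inl, Finset.mul_sum, mul_assoc]
      have e2 : ∑ i, ∑ j, aP K d i * xP K d j *
          embXY K d (derivX i (F j) - derivX j (F i)) = -(((n : K) + 1) • constOf F) := by
        rw [e1, Finset.sum_comm, ← Finset.sum_neg_distrib]
        refine Finset.sum_congr rfl fun i _ => ?_
        rw [← Finset.sum_neg_distrib]
        refine Finset.sum_congr rfl fun j _ => ?_
        simp only [map_sub]; ring
      simp only [sub_mul, Finset.sum_sub_distrib]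
      rw [e2, ← e1, mul_smul, two_smul, sub_neg_eq_add]
    have hc : (2 * ((n : K) + 1)) ≠ 0 := by
      exact_mod_cast (by positivity : 2 * (n + 1) ≠ 0)
    rw [← (Lsub K d δ).smul_mem_iff hc, hsum]
    exact Submodule.sum_mem _ fun i _ => Submodule.sum_mem _ fun j _ =>
      mul_mem_Lsub hδ (aP_mul_xP_sub_mem j i) (hH i j)
  · have hc : ((2 * (m : ℤ) * ((n : ℤ) + 2) : ℤ) : K) ≠ 0 := by
      rw [Int.cast_ne_zero]
      positivity
    have hsum : ((2 * (m : ℤ) * ((n : ℤ) + 2) : ℤ) : K) • constOf F =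
        ∑ i, ∑ j, (uP K d i j * constOf (fun k => cayley i j (F k)) -
          wP K d i j * piSubst K d (constOf fun k => cayley i j (F k))) +
        ∑ i, ∑ j, (wP K d i j + wP K d j i) * embXY K d (mixed F i j) := by
      have e : ∑ i, ∑ j, wP K d j i * embXY K d (mixed F i j) =
          ∑ i, ∑ j, wP K d i j * embXY K d (mixed F j i) := Finset.sum_comm
      rw [capelli_constOf hF hE]
      simp only [piSubst_constOf_cayley hπ, mul_sub, add_mul, Finset.sum_sub_distrib,
        Finset.sum_add_distrib, e]
      ring
    rw [← (Lsub K d δ).smul_mem_iff hc, hsum]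
    refine Submodule.add_mem _ ?_ ?_
    · refine Submodule.sum_mem _ fun i _ => Submodule.sum_mem _ fun j _ => ?_
      refine uP_mul_constOf_sub_mem hδ i j (fun k => (hF k).map_cayley i j) fun k => ?_
      rw [weitz_cayley, weitz_cayley, hE]
      simp [cayley]
    · exact Submodule.sum_mem _ fun i _ => Submodule.sum_mem _ fun j _ =>
        mul_mem_Lsub hδ (wP_add_wP_mem i j) (weitz_mixed hE i j)

lemma constOf_mem_Lsub [CharZero K]
    (hδ : ∀ p : P, δ (embXY K d p) = embXY K d (weitz K d p)) {F : Fin d → P}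
    (hE : ∀ k, weitz K d (weitz K d (F k)) = 0)
    (hπ : ∑ k, X (Sum.inl k) * F k - ∑ k, X (Sum.inr k) * weitz K d (F k) = 0) :
    constOf F ∈ Lsub K d δ := by
  obtain ⟨S, hS⟩ := exists_finset_sum_components F
  rw [show F = fun k => ∑ w ∈ S, weightedHomogeneousComponent (biweight d) w (F k) from
    funext hS, constOf_sum]
  refine Submodule.sum_mem _ fun w _ => ?_
  have hF (k : Fin d) : IsWeightedHomogeneous (biweight d)
      (weightedHomogeneousComponent (biweight d) w (F k)) w :=
    weightedHomogeneousComponent_isWeightedHomogeneous _ _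
  by_cases hw : 0 ≤ w.1 ∧ 0 ≤ w.2
  · obtain ⟨⟨n, hn⟩, ⟨m, hm⟩⟩ := hw.imp Int.eq_ofNat_of_zero_le Int.eq_ofNat_of_zero_le
    obtain rfl : w = ((n : ℤ), (m : ℤ)) := Prod.ext hn hm
    refine constOf_mem_Lsub_of_homogeneous hδ hF (fun k => ?_) ?_
    · rw [← weightedHomogeneousComponent_weitz, ← weightedHomogeneousComponent_weitz, hE,
        map_zero]
    · have h := congrArg
        (weightedHomogeneousComponent (biweight d) (((n : ℤ), (m : ℤ)) + (1, 0))) hπ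
      simp only [map_sub, map_sum, map_zero, weightedHomogeneousComponent_X_inl_mul] at h
      rw [← h]
      congr 1
      refine Finset.sum_congr rfl fun k _ => ?_
      rw [← weightedHomogeneousComponent_weitz, ← weightedHomogeneousComponent_X_inr_mul]
      congr 2
      ext <;> simp
  · have h0 (k : Fin d) : weightedHomogeneousComponent (biweight d) w (F k) = 0 :=
      (IsWeightedHomogeneous.eq_zero_or_nonneg (n := w.1) (m := w.2) (hF k)).resolve_right hw
    simp [constOf, h0]

end Lsub

/-- The elements `aᵢ`, `bᵢ` are linearly independent over `K[X_d,Y_d]`. -/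
lemma eq_zero_of_sum_eq_zero {F G : Fin d → P}
    (h : ∑ i, aP K d i * embXY K d (F i) + ∑ i, bP K d i * embXY K d (G i) = 0) (k : Fin d) :
    F k = 0 ∧ G k = 0 := by
  classical
  have hv (v : Fin d ⊕ Fin d) (p : P) : pderiv (Sum.inl v) (embXY K d p) = 0 := by
    refine pderiv_eq_zero_of_notMem_vars fun hv => ?_
    have := vars_rename Sum.inr p hv
    simp at this
  constructor <;> apply embXY_injective
  · have := congrArg (pderiv (Sum.inl (Sum.inl k))) h
    simpa [Derivation.leibniz, hv, aP, bP, pderiv_X, Pi.single_apply] using this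
  · have := congrArg (pderiv (Sum.inl (Sum.inr k))) h
    simpa [Derivation.leibniz, hv, aP, bP, pderiv_X, Pi.single_apply] using this

end Lie

/-- An element `f` of `C_{2d}` is a constant of `δ` killed by the substitution
`aᵢ ↦ xᵢ`, `bᵢ ↦ yᵢ` (i.e. a Lie element of `C_{2d}^δ`) if and only if `f ∈ L`. -/
theorem lie_constants_eq_L (K : Type*) [Field K] [CharZero K] (d : ℕ) (hd : 2 ≤ d)
    (δ : Derivation K (MvPolynomial (Var4 d) K) (MvPolynomial (Var4 d) K))
    (ha : ∀ i : Fin d, δ (aP K d i) = 0)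
    (hb : ∀ i : Fin d, δ (bP K d i) = aP K d i)
    (hx : ∀ i : Fin d, δ (xP K d i) = 0)
    (hy : ∀ i : Fin d, δ (yP K d i) = xP K d i)
    (f : MvPolynomial (Var4 d) K) (hf : f ∈ Cmod K d) :
    (δ f = 0 ∧ piSubst K d f = 0) ↔ f ∈ Lsub K d δ := by
  have hδ := derivation_embXY hx hy
  constructor
  · rintro ⟨hδf, hπf⟩
    obtain ⟨F, G, rfl⟩ := hf
    have h : ∑ i, aP K d i * embXY K d (weitz K d (F i) + G i) +
        ∑ i, bP K d i * embXY K d (weitz K d (G i)) = 0 := by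
      rw [← hδf]
      simp only [map_add, map_sum, Derivation.leibniz, smul_eq_mul, ha, hb, hδ, zero_mul,
        add_zero, mul_add, Finset.sum_add_distrib, mul_comm (embXY K d _)]
      ring
    have hG (k : Fin d) : G k = -weitz K d (F k) := by
      rw [eq_neg_iff_add_eq_zero, add_comm]
      exact (eq_zero_of_sum_eq_zero h k).1
    have hf : ∑ i, aP K d i * embXY K d (F i) + ∑ i, bP K d i * embXY K d (G i) =
        constOf F := by
      simp [constOf, hG, sub_eq_add_neg]
    rw [hf] at hπf ⊢
    refine constOf_mem_Lsub hδ (fun k => ?_) (embXY_injective ?_)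
    · have := (eq_zero_of_sum_eq_zero h k).2
      rwa [hG, map_neg, neg_eq_zero] at this
    · rw [← piSubst_constOf, hπf, map_zero]
  · intro h
    clear hf
    induction h using Submodule.span_induction with
    | zero => simp
    | add y z _ _ hy hz => simp [hy.1, hy.2, hz.1, hz.2]
    | smul c z _ hz => simp [hz.1, hz.2]
    | mem z hz =>
      obtain ⟨g, hg, h, hh, rfl⟩ := hz
      suffices hg' : δ g = 0 ∧ piSubst K d g = 0 by
        simp [Derivation.leibniz, hh, hg'.1, hg'.2]
      have hu (p q : Fin d) : δ (uP K d p q) = 0 := by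
        simp [uP, Derivation.leibniz, hx, hy, mul_comm]
      have hw (p q : Fin d) : δ (wP K d p q) = 0 := by
        simp [wP, Derivation.leibniz, hx, hy, ha, hb, mul_comm]
      rcases hg with ((((⟨i, rfl⟩ | ⟨i, j, -, rfl⟩) | ⟨i, j, -, rfl⟩) | ⟨i, p, q, -, rfl⟩) |
        ⟨i, j, k, -, -, rfl⟩) | ⟨i, j, p, q, -, -, rfl⟩ <;>
      refine ⟨by simp [Derivation.leibniz, hu, hw, ha, hx], ?_⟩ <;>
      simp only [map_add, map_sub, map_mul, piSubst_wP, piSubst_aP, piSubst_xP, piSubst_yP,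
        uP] <;> ring

end
end

section
/- Every element f of C_{2d} with δ(f) = 0 can be written as a sum f = g + h, where g ∈ L and h is a K-linear combination of elements of the following two families: (i) w_{p_0 q_0}·u_{p_1 q_1}⋯u_{p_r q_r} with r ≥ 0, 1 ≤ p_t < q_t ≤ d for t = 0,…,r, such that the product u_{p_0 q_0}·u_{p_1 q_1}⋯u_{p_r q_r} is canonical (no two of the open intervals (p_α, q_α), (p_β, q_β) cross, i.e., there are no α, β with p_α < p_β < q_α < q_β); (ii) a_{i_0}·x_{i_1}⋯x_{i_m}·u_{k_1 l_1}⋯u_{k_s l_s} with m, s ≥ 0, such that the product x_{i_0}·x_{i_1}⋯x_{i_m}·u_{k_1 l_1}⋯u_{k_s l_s} is canonical (no two intervals (k_α, l_α), (k_β, l_β) cross, and no index among i_0, i_1, …, i_m satisfies k_α < i_γ < l_α for any α). In particular these elements together with L span the vector space C_{2d}^δ = {f ∈ C_{2d} : δ(f) = 0}. -/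
open MvPolynomial

noncomputable section

variable (K : Type*) [Field K] (d : ℕ)

/-- The spanning elements `w_{p₀q₀}·u_{p₁q₁}⋯u_{p_r q_r}` where the product
`u_{p₀q₀}·u_{p₁q₁}⋯u_{p_r q_r}` is canonical (no two intervals cross). -/
def Fam1 : Set (MvPolynomial (Var4 d) K) :=
  {z | ∃ (pq0 : {pq : Fin d × Fin d // pq.1 < pq.2})
        (m : Multiset {pq : Fin d × Fin d // pq.1 < pq.2}),
      (∀ a ∈ pq0 ::ₘ m, ∀ b ∈ pq0 ::ₘ m, ¬(a.1.1 < b.1.1 ∧ b.1.1 < a.1.2 ∧ a.1.2 < b.1.2)) ∧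
      z = wP K d pq0.1.1 pq0.1.2 * (m.map fun a => uP K d a.1.1 a.1.2).prod}

/-- The spanning elements `a_{i₀}·x_{i₁}⋯x_{i_m}·u_{k₁l₁}⋯u_{k_s l_s}` where the product
`x_{i₀}·x_{i₁}⋯x_{i_m}·u_{k₁l₁}⋯u_{k_s l_s}` is canonical (no two intervals cross and no
index among `i₀,…,i_m` is covered by an interval). -/
def Fam2 : Set (MvPolynomial (Var4 d) K) :=
  {z | ∃ (i0 : Fin d) (e : Fin d →₀ ℕ) (m : Multiset {pq : Fin d × Fin d // pq.1 < pq.2}),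
      (∀ a ∈ m, ∀ b ∈ m, ¬(a.1.1 < b.1.1 ∧ b.1.1 < a.1.2 ∧ a.1.2 < b.1.2)) ∧
      (∀ a ∈ m, ∀ γ : Fin d, (γ = i0 ∨ e γ ≠ 0) → ¬(a.1.1 < γ ∧ γ < a.1.2)) ∧
      z = aP K d i0 * (e.prod fun γ n => xP K d γ ^ n) *
            (m.map fun a => uP K d a.1.1 a.1.2).prod}

section Polarization

variable {σ I : Type*} {K}

theorem weightedHomogeneousComponent_pderiv (w : σ → ℕ) (i : σ) (k : ℕ) (f : MvPolynomial σ K) :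
    weightedHomogeneousComponent w k (pderiv i f) =
      pderiv i (weightedHomogeneousComponent w (k + w i) f) := by
  classical
  ext m
  simp only [coeff_weightedHomogeneousComponent, coeff_pderiv, map_add, Finsupp.weight_single,
    one_smul, add_left_inj, ite_mul, zero_mul]

theorem weightedHomogeneousComponent_X_mul (w : σ → ℕ) (i : σ) (k : ℕ) (f : MvPolynomial σ K) :
    weightedHomogeneousComponent w (k + w i) (X i * f) =
      X i * weightedHomogeneousComponent w k f := by
  classical
  ext m
  simp only [coeff_weightedHomogeneousComponent, coeff_X_mul']
  by_cases h : i ∈ m.support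
  · have := Finsupp.weight_sub_single_add (w := w) (Finsupp.mem_support_iff.mp h)
    simp only [h, if_true, ← this, add_left_inj]
  · simp [h]

/-- The polarization derivation sending the second half of the variables to the first half,
and the first half to zero. -/
def polarization [Fintype I] (e : I ⊕ I ≃ σ) :
    Derivation K (MvPolynomial σ K) (MvPolynomial σ K) :=
  ∑ p, (X (e (.inl p)) : MvPolynomial σ K) • pderiv (e (.inr p))

/-- The bracket `x_p y_q - x_q y_p` of two pairs of variables. -/
def bracket (e : I ⊕ I ≃ σ) (p q : I) : MvPolynomial σ K :=
  X (e (.inl p)) * X (e (.inr q)) - X (e (.inl q)) * X (e (.inr p))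

/-- The operator `∂x_p ∂y_q - ∂x_q ∂y_p`. -/
def omegaOp (e : I ⊕ I ≃ σ) (p q : I) (f : MvPolynomial σ K) : MvPolynomial σ K :=
  pderiv (e (.inl p)) (pderiv (e (.inr q)) f) - pderiv (e (.inl q)) (pderiv (e (.inr p)) f)

/-- The subalgebra generated by the first half of the variables and the brackets. -/
def bracketAlgebra (K : Type*) [Field K] (e : I ⊕ I ≃ σ) : Subalgebra K (MvPolynomial σ K) :=
  Algebra.adjoin K ((Set.range fun p => X (e (.inl p))) ∪
    Set.range fun pq : I × I => bracket e pq.1 pq.2)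

variable (e : I ⊕ I ≃ σ)

theorem mem_bracketAlgebra_of_weight_zero {w : σ → ℕ} (hw : ∀ p, w (e (.inr p)) ≠ 0)
    {f : MvPolynomial σ K} (hf : f.IsWeightedHomogeneous w 0) : f ∈ bracketAlgebra K e := by
  rw [f.as_sum]
  refine sum_mem fun d hd => ?_
  rw [monomial_eq, C_mul']
  refine Subalgebra.smul_mem _ (Subalgebra.prod_mem _ fun v hv => Subalgebra.pow_mem _ ?_ _) _
  have h0 := hf (mem_support_iff.mp hd)
  obtain ⟨p | p, rfl⟩ := e.surjective v
  · exact Algebra.subset_adjoin (.inl ⟨p, rfl⟩)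
  · have := Finsupp.le_weight w (hw p) d
    exact absurd (Nat.le_zero.mp (h0 ▸ this)) (Finsupp.mem_support_iff.mp hv)

variable [Fintype I]

theorem polarization_apply (f : MvPolynomial σ K) :
    polarization e f = ∑ p, X (e (.inl p)) * pderiv (e (.inr p)) f := by
  rw [polarization, ← Derivation.coeFnAddMonoidHom_apply, map_sum, Finset.sum_apply]
  rfl

theorem weightedHomogeneousComponent_polarization (w : σ → ℕ) (wx wy : ℕ)
    (hx : ∀ p, w (e (.inl p)) = wx) (hy : ∀ p, w (e (.inr p)) = wy) (k : ℕ)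
    (f : MvPolynomial σ K) :
    weightedHomogeneousComponent w (k + wx) (polarization e f) =
      polarization e (weightedHomogeneousComponent w (k + wy) f) := by
  simp only [polarization_apply, map_sum]
  refine Finset.sum_congr rfl fun p _ => ?_
  rw [← hx p, weightedHomogeneousComponent_X_mul, weightedHomogeneousComponent_pderiv, hy p]

theorem pderiv_comm_apply (i j : σ) (f : MvPolynomial σ K) :
    pderiv i (pderiv j f) = pderiv j (pderiv i f) := by
  classical
  have h : ⁅(pderiv i : Derivation K (MvPolynomial σ K) (MvPolynomial σ K)),
      (pderiv j : Derivation K (MvPolynomial σ K) (MvPolynomial σ K))⁆ = 0 := by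
    refine derivation_ext fun k => ?_
    simp [Derivation.commutator_apply, pderiv_X, Pi.single_apply, apply_ite]
  exact sub_eq_zero.mp (by simpa [Derivation.commutator_apply] using DFunLike.congr_fun h f)

theorem polarization_pderiv_inr (p : I) (f : MvPolynomial σ K) :
    polarization e (pderiv (e (.inr p)) f) = pderiv (e (.inr p)) (polarization e f) := by
  classical
  simp only [polarization_apply, map_sum]
  refine Finset.sum_congr rfl fun q _ => ?_
  rw [Derivation.leibniz, pderiv_X_of_ne (by simp), pderiv_comm_apply]
  simp

theorem pderiv_inl_polarization (p : I) (f : MvPolynomial σ K) :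
    pderiv (e (.inl p)) (polarization e f) =
      pderiv (e (.inr p)) f + polarization e (pderiv (e (.inl p)) f) := by
  classical
  simp only [polarization_apply, map_sum, Derivation.leibniz, smul_eq_mul, Finset.sum_add_distrib]
  rw [add_comm]
  congr 1
  · simp [pderiv_X, Pi.single_apply]
  · exact Finset.sum_congr rfl fun q _ => by rw [pderiv_comm_apply]

theorem polarization_omegaOp {f : MvPolynomial σ K} (hf : polarization e f = 0) (p q : I) :
    polarization e (omegaOp e p q f) = 0 := by
  have h (p q : I) : polarization e (pderiv (e (.inl p)) (pderiv (e (.inr q)) f)) =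
      -pderiv (e (.inr p)) (pderiv (e (.inr q)) f) := by
    have := pderiv_inl_polarization e p (pderiv (e (.inr q)) f)
    rw [polarization_pderiv_inr, hf, map_zero, map_zero] at this
    linear_combination -this
  rw [omegaOp, map_sub, h, h, pderiv_comm_apply]
  ring

/-- A form of Capelli's identity on the kernel of the polarization derivation. -/
theorem sum_bracket_mul_omegaOp {f : MvPolynomial σ K} (hf : polarization e f = 0) (m n : ℕ)
    (hm : ∑ p, X (e (.inl p)) * pderiv (e (.inl p)) f = m • f)
    (hn : ∑ p, X (e (.inr p)) * pderiv (e (.inr p)) f = n • f) :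
    ∑ p, ∑ q, bracket e p q * omegaOp e p q f = (2 * ((m + 1) * n)) • f := by
  have h1 : ∑ p, ∑ q, X (e (.inl p)) * X (e (.inr q)) *
      pderiv (e (.inl p)) (pderiv (e (.inr q)) f) = (n * m) • f := by
    have h (p : I) : ∑ q, X (e (.inl p)) * X (e (.inr q)) *
        pderiv (e (.inl p)) (pderiv (e (.inr q)) f) =
        n • (X (e (.inl p)) * pderiv (e (.inl p)) f) := by
      have := congrArg (pderiv (e (.inl p))) hn
      rw [map_sum, map_nsmul] at this
      rw [← mul_smul_comm, ← this, Finset.mul_sum]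
      refine Finset.sum_congr rfl fun q _ => ?_
      rw [Derivation.leibniz, pderiv_X_of_ne (by simp)]
      simp [mul_assoc]
    simp only [h, ← Finset.smul_sum, hm, mul_smul]
  have h2 : ∑ p, ∑ q, X (e (.inl p)) * X (e (.inr q)) *
      pderiv (e (.inl q)) (pderiv (e (.inr p)) f) = -(n • f) := by
    rw [Finset.sum_comm, ← hn, ← Finset.sum_neg_distrib]
    refine Finset.sum_congr rfl fun q _ => ?_
    have := pderiv_inl_polarization e q f
    rw [hf, map_zero, polarization_apply] at this
    rw [← mul_neg, ← eq_neg_of_add_eq_zero_right this.symm, Finset.mul_sum]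
    refine Finset.sum_congr rfl fun p _ => ?_
    rw [pderiv_comm_apply]
    ring
  have h3 : ∑ p, ∑ q, bracket e p q * omegaOp e p q f =
      2 * ∑ p, ∑ q, X (e (.inl p)) * X (e (.inr q)) *
        pderiv (e (.inl p)) (pderiv (e (.inr q)) f) -
      2 * ∑ p, ∑ q, X (e (.inl p)) * X (e (.inr q)) *
        pderiv (e (.inl q)) (pderiv (e (.inr p)) f) := by
    have h4 := Finset.sum_comm (s := Finset.univ) (t := Finset.univ) (f := fun p q : I =>
      X (e (.inl p)) * X (e (.inr q)) * pderiv (e (.inl p)) (pderiv (e (.inr q)) f))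
    have h5 := Finset.sum_comm (s := Finset.univ) (t := Finset.univ) (f := fun p q : I =>
      X (e (.inl p)) * X (e (.inr q)) * pderiv (e (.inl q)) (pderiv (e (.inr p)) f))
    rw [two_mul, two_mul]
    nth_rewrite 2 [h4]
    nth_rewrite 2 [h5]
    simp only [← Finset.sum_add_distrib, ← Finset.sum_sub_distrib]
    refine Finset.sum_congr rfl fun p _ => Finset.sum_congr rfl fun q _ => ?_
    rw [bracket, omegaOp]
    ring
  rw [h3, h1, h2]
  simp only [nsmul_eq_mul]
  push_cast
  ring

variable [CharZero K] [Fintype σ]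

theorem mem_bracketAlgebra_of_homogeneous (n : ℕ) {f : MvPolynomial σ K}
    (hn : f.IsWeightedHomogeneous (fun v => Sum.elim 0 1 (e.symm v)) n)
    (hf : polarization e f = 0) : f ∈ bracketAlgebra K e := by
  classical
  induction n generalizing f with
  | zero => exact mem_bracketAlgebra_of_weight_zero e (by simp) hn
  | succ n ih =>
    set wx : σ → ℕ := fun v => Sum.elim 1 0 (e.symm v) with hwx
    rw [← sum_weightedHomogeneousComponent wx f,
      finsum_eq_sum _ (weightedHomogeneousComponent_finsupp f)]
    refine sum_mem fun m _ => ?_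
    set g := weightedHomogeneousComponent wx m f with hg
    have hgm : g.IsWeightedHomogeneous wx m := weightedHomogeneousComponent_isWeightedHomogeneous m f
    have hgn : g.IsWeightedHomogeneous (fun v => Sum.elim 0 1 (e.symm v)) (n + 1) := by
      intro d hd
      rw [hg, coeff_weightedHomogeneousComponent] at hd
      exact hn (ite_ne_right_iff.mp hd).2
    have hg0 : polarization e g = 0 := by
      have := weightedHomogeneousComponent_polarization e wx 1 0 (by simp [hwx]) (by simp [hwx]) m f
      rw [hf, map_zero] at this
      exact this.symm
    have key := sum_bracket_mul_omegaOp e hg0 m (n + 1)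
      (by simpa [hwx, ← e.sum_comp] using hgm.sum_weight_X_mul_pderiv)
      (by simpa [← e.sum_comp] using hgn.sum_weight_X_mul_pderiv)
    have hmem : (2 * ((m + 1) * (n + 1))) • g ∈ bracketAlgebra K e := by
      rw [← key]
      refine sum_mem fun p _ => sum_mem fun q _ =>
        mul_mem (Algebra.subset_adjoin (.inr ⟨(p, q), rfl⟩)) (ih ?_ (polarization_omegaOp e hg0 p q))
      have h (p q : I) := (hgn.pderiv (i := e (.inr q)) (n' := n) (by simp)).pderiv
        (i := e (.inl p)) (n' := n) (by simp)
      exact (h p q).sub (h q p)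
    rw [← Nat.cast_smul_eq_nsmul K] at hmem
    have hc : ((2 * ((m + 1) * (n + 1)) : ℕ) : K) ≠ 0 := by
      rw [Nat.cast_ne_zero]; positivity
    have := (bracketAlgebra K e).smul_mem hmem ((2 * ((m + 1) * (n + 1)) : ℕ) : K)⁻¹
    rwa [smul_smul, inv_mul_cancel₀ hc, one_smul] at this

/-- Nowicki's conjecture: the constants of the polarization derivation are generated by the
first half of the variables and the brackets. -/
theorem mem_bracketAlgebra_of_polarization_eq_zero {f : MvPolynomial σ K}
    (hf : polarization e f = 0) : f ∈ bracketAlgebra K e := by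
  set wy : σ → ℕ := fun v => Sum.elim 0 1 (e.symm v) with hwy
  rw [← sum_weightedHomogeneousComponent wy f,
    finsum_eq_sum _ (weightedHomogeneousComponent_finsupp f)]
  refine sum_mem fun n _ => ?_
  have hn := weightedHomogeneousComponent_isWeightedHomogeneous (w := wy) n f
  cases n with
  | zero => exact mem_bracketAlgebra_of_weight_zero e (by simp [hwy]) hn
  | succ n =>
    refine mem_bracketAlgebra_of_homogeneous e (n + 1) hn ?_
    have := weightedHomogeneousComponent_polarization e wy 0 1 (by simp [hwy]) (by simp [hwy]) n f
    rw [hf, map_zero] at this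
    exact this.symm

end Polarization

section DegreeOne

/-- The constants of `K[X_d,Y_d]`, seen inside `K[A_d,B_d,X_d,Y_d]`: the subalgebra generated by
the `xᵢ` and the `u_{pq}`. -/
def constXY : Subalgebra K (MvPolynomial (Var4 d) K) :=
  Algebra.adjoin K ((Set.range fun i => xP K d i) ∪ Set.range fun pq : Fin d × Fin d =>
    uP K d pq.1 pq.2)

/-- The `constXY`-module generated by the `aᵢ` and the `w_{pq}`. -/
def constAB : Submodule (constXY K d) (MvPolynomial (Var4 d) K) :=
  Submodule.span (constXY K d) ((Set.range fun i => aP K d i) ∪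
    Set.range fun pq : Fin d × Fin d => wP K d pq.1 pq.2)

/-- The homomorphism multiplying the variables `aᵢ`, `bᵢ` by `ε`. -/
def scaleAB : MvPolynomial (Var4 d) K →ₐ[K] DualNumber (MvPolynomial (Var4 d) K) :=
  aeval (Sum.elim (fun v => TrivSqZeroExt.inr (X (.inl v))) fun v => TrivSqZeroExt.inl (X (.inr v)))

variable {K d}

@[simp] theorem scaleAB_aP (i : Fin d) : scaleAB K d (aP K d i) = TrivSqZeroExt.inr (aP K d i) := by
  simp [scaleAB, aP]

@[simp] theorem scaleAB_bP (i : Fin d) : scaleAB K d (bP K d i) = TrivSqZeroExt.inr (bP K d i) := by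
  simp [scaleAB, bP]

@[simp] theorem scaleAB_xP (i : Fin d) : scaleAB K d (xP K d i) = TrivSqZeroExt.inl (xP K d i) := by
  simp [scaleAB, xP]

@[simp] theorem scaleAB_yP (i : Fin d) : scaleAB K d (yP K d i) = TrivSqZeroExt.inl (yP K d i) := by
  simp [scaleAB, yP]

theorem scaleAB_embXY (h : MvPolynomial (Fin d ⊕ Fin d) K) :
    scaleAB K d (embXY K d h) = TrivSqZeroExt.inl (embXY K d h) := by
  have : (scaleAB K d).comp (embXY K d) =
      (TrivSqZeroExt.inlAlgHom K (MvPolynomial (Var4 d) K) (MvPolynomial (Var4 d) K)).comp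
        (embXY K d) := by
    ext v : 1
    simp [scaleAB, embXY]
  exact DFunLike.congr_fun this h

theorem snd_scaleAB {f : MvPolynomial (Var4 d) K} (hf : f ∈ Cmod K d) :
    (scaleAB K d f).snd = f := by
  obtain ⟨F, G, rfl⟩ := hf
  simp [scaleAB_embXY, TrivSqZeroExt.snd_sum]

theorem scaleAB_mem {f : MvPolynomial (Var4 d) K}
    (hf : f ∈ bracketAlgebra K (Equiv.sumSumSumComm (Fin d) (Fin d) (Fin d) (Fin d))) :
    (scaleAB K d f).fst ∈ constXY K d ∧ (scaleAB K d f).snd ∈ constAB K d := by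
  have hx (i : Fin d) : xP K d i ∈ constXY K d := Algebra.subset_adjoin (.inl ⟨i, rfl⟩)
  have hu (p q : Fin d) : uP K d p q ∈ constXY K d := Algebra.subset_adjoin (.inr ⟨(p, q), rfl⟩)
  have ha (i : Fin d) : aP K d i ∈ constAB K d := Submodule.subset_span (.inl ⟨i, rfl⟩)
  have hw (p q : Fin d) : wP K d p q ∈ constAB K d := Submodule.subset_span (.inr ⟨(p, q), rfl⟩)
  induction hf using Algebra.adjoin_induction with
  | mem f hf =>
    rcases hf with ⟨i | i, rfl⟩ | ⟨⟨p | p, q | q⟩, rfl⟩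
    · change (scaleAB K d (aP K d i)).fst ∈ _ ∧ (scaleAB K d (aP K d i)).snd ∈ _
      simp [ha, zero_mem]
    · change (scaleAB K d (xP K d i)).fst ∈ _ ∧ (scaleAB K d (xP K d i)).snd ∈ _
      simp [hx, zero_mem]
    · have h : bracket (Equiv.sumSumSumComm (Fin d) (Fin d) (Fin d) (Fin d)) (.inl p) (.inl q) =
        aP K d p * bP K d q - aP K d q * bP K d p := rfl
      simp [h, zero_mem]
    · have h : bracket (Equiv.sumSumSumComm (Fin d) (Fin d) (Fin d) (Fin d)) (.inl p) (.inr q) =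
        aP K d p * yP K d q - xP K d q * bP K d p := rfl
      simpa [h, zero_mem, wP, mul_comm] using hw p q
    · have h : bracket (Equiv.sumSumSumComm (Fin d) (Fin d) (Fin d) (Fin d)) (.inr p) (.inl q) =
        xP K d p * bP K d q - aP K d q * yP K d p := rfl
      simpa [h, zero_mem, wP, mul_comm] using neg_mem (hw q p)
    · have h : bracket (Equiv.sumSumSumComm (Fin d) (Fin d) (Fin d) (Fin d)) (.inr p) (.inr q) =
        xP K d p * yP K d q - xP K d q * yP K d p := rfl
      simpa [h, zero_mem, uP] using hu p q
  | algebraMap r =>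
    rw [AlgHom.commutes]
    exact ⟨(constXY K d).algebraMap_mem r, (constAB K d).zero_mem⟩
  | add f g _ _ hf hg =>
    rw [map_add]
    exact ⟨add_mem hf.1 hg.1, add_mem hf.2 hg.2⟩
  | mul f g _ _ hf hg =>
    rw [map_mul]
    refine ⟨mul_mem hf.1 hg.1, ?_⟩
    rw [DualNumber.snd_mul]
    refine add_mem ((constAB K d).smul_mem ⟨_, hf.1⟩ hg.2) ?_
    rw [mul_comm]
    exact (constAB K d).smul_mem ⟨_, hg.1⟩ hf.2

theorem mem_constAB [CharZero K] {f : MvPolynomial (Var4 d) K} (hf : f ∈ Cmod K d)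
    (h : polarization (Equiv.sumSumSumComm (Fin d) (Fin d) (Fin d) (Fin d)) f = 0) :
    f ∈ constAB K d :=
  snd_scaleAB hf ▸ (scaleAB_mem (mem_bracketAlgebra_of_polarization_eq_zero _ h)).2

theorem eq_polarization {δ : Derivation K (MvPolynomial (Var4 d) K) (MvPolynomial (Var4 d) K)}
    (ha : ∀ i : Fin d, δ (aP K d i) = 0) (hb : ∀ i : Fin d, δ (bP K d i) = aP K d i)
    (hx : ∀ i : Fin d, δ (xP K d i) = 0) (hy : ∀ i : Fin d, δ (yP K d i) = xP K d i) :
    δ = polarization (Equiv.sumSumSumComm (Fin d) (Fin d) (Fin d) (Fin d)) := by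
  classical
  refine derivation_ext fun v => ?_
  rw [polarization_apply]
  rcases v with (i | i) | (i | i)
  · simpa [pderiv_X, Pi.single_apply, aP] using ha i
  · simpa [pderiv_X, Pi.single_apply, bP, aP] using hb i
  · simpa [pderiv_X, Pi.single_apply, xP] using hx i
  · simpa [pderiv_X, Pi.single_apply, xP, yP] using hy i

end DegreeOne

section Straightening

/-- The index set of the brackets `u_{pq}` with `p < q`. -/
abbrev Arc : Type := {pq : Fin d × Fin d // pq.1 < pq.2}

/-- The product of the `x_γ` with exponents `e`. -/
def xMon (e : Fin d →₀ ℕ) : MvPolynomial (Var4 d) K := e.prod fun γ n => xP K d γ ^ n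

/-- The product of the `u_{pq}` over a multiset of arcs. -/
def uMon (m : Multiset (Arc d)) : MvPolynomial (Var4 d) K :=
  (m.map fun a => uP K d a.1.1 a.1.2).prod

variable {d} in
/-- A strictly increasing, strictly concave function of the length of an arc. -/
def arcCost (a : Arc d) : ℕ := (a.1.2.1 - a.1.1.1) * (2 * d - (a.1.2.1 - a.1.1.1))

variable {d} in
/-- The quantity that decreases under straightening. -/
def arcsCost (m : Multiset (Arc d)) : ℕ := (m.map arcCost).sum

variable {K d}

theorem arcCost_cast (a : Arc d) : (arcCost a : ℤ) =
    ((a.1.2.1 : ℤ) - a.1.1.1) * (2 * d - (a.1.2.1 - a.1.1.1)) := by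
  have h1 : a.1.1.1 < a.1.2.1 := a.2
  have h2 := a.1.2.2
  rw [arcCost, Nat.cast_mul, Nat.cast_sub (by omega), Nat.cast_sub (by omega),
    Nat.cast_sub (by omega)]
  push_cast
  ring

theorem arcCost_lt {i k i' k' : Fin d} (h : i < k) (h1 : i ≤ i') (h' : i' < k') (h2 : k' ≤ k)
    (h3 : i < i' ∨ k' < k) : arcCost (⟨(i', k'), h'⟩ : Arc d) < arcCost ⟨(i, k), h⟩ := by
  zify
  rw [arcCost_cast, arcCost_cast]
  simp only [Fin.lt_def, Fin.le_def] at *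
  have := k.2
  have h4 : (0 : ℤ) < (k.1 - i.1) - (k'.1 - i'.1) := by omega
  have h5 : (0 : ℤ) < 2 * d - (k.1 - i.1) - (k'.1 - i'.1) := by omega
  nlinarith [mul_pos h4 h5]

theorem arcCost_add_lt {i j k l : Fin d} (hij : i < j) (hjk : j < k) (hkl : k < l) :
    arcCost (⟨(i, l), hij.trans (hjk.trans hkl)⟩ : Arc d) + arcCost ⟨(j, k), hjk⟩ <
      arcCost (⟨(i, k), hij.trans hjk⟩ : Arc d) + arcCost ⟨(j, l), hjk.trans hkl⟩ := by
  zify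
  simp only [arcCost_cast]
  have h1 : (i.1 : ℤ) < j := by exact_mod_cast hij
  have h2 : (k.1 : ℤ) < l := by exact_mod_cast hkl
  nlinarith [mul_pos (sub_pos.mpr h1) (sub_pos.mpr h2)]

@[simp] theorem arcsCost_cons (a : Arc d) (m : Multiset (Arc d)) :
    arcsCost (a ::ₘ m) = arcCost a + arcsCost m := by
  simp [arcsCost]

@[simp] theorem uMon_cons (a : Arc d) (m : Multiset (Arc d)) :
    uMon K d (a ::ₘ m) = uP K d a.1.1 a.1.2 * uMon K d m := by
  simp [uMon]

theorem xMon_add_single (e : Fin d →₀ ℕ) (γ : Fin d) :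
    xMon K d (e + Finsupp.single γ 1) = xMon K d e * xP K d γ := by
  rw [xMon, Finsupp.prod_add_index' (by simp) (by simp [pow_add]), Finsupp.prod_single_index (by simp),
    pow_one, xMon]

theorem uMon_mem_constXY (m : Multiset (Arc d)) : uMon K d m ∈ constXY K d := by
  refine multiset_prod_mem (S := constXY K d) _ fun z hz => ?_
  obtain ⟨a, -, rfl⟩ := Multiset.mem_map.mp hz
  exact Algebra.subset_adjoin (.inr ⟨a.1, rfl⟩)

theorem xMon_mem_constXY (e : Fin d →₀ ℕ) : xMon K d e ∈ constXY K d :=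
  prod_mem (S := constXY K d) fun γ _ => pow_mem (Algebra.subset_adjoin (.inl ⟨γ, rfl⟩)) _

/-- Every element of `constXY` is a linear combination of products of variables and brackets of
arcs. -/
theorem constXY_le_span : Subalgebra.toSubmodule (constXY K d) ≤
    Submodule.span K (Set.range fun em : (Fin d →₀ ℕ) × Multiset (Arc d) =>
      xMon K d em.1 * uMon K d em.2) := by
  set N := Submodule.span K (Set.range fun em : (Fin d →₀ ℕ) × Multiset (Arc d) =>
      xMon K d em.1 * uMon K d em.2)
  have mul_x (γ : Fin d) {z} (hz : z ∈ N) : z * xP K d γ ∈ N := by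
    induction hz using Submodule.span_induction with
    | mem z hz =>
      obtain ⟨⟨e, m⟩, rfl⟩ := hz
      refine Submodule.subset_span ⟨(e + Finsupp.single γ 1, m), ?_⟩
      simp only [xMon_add_single]
      ring
    | zero => simp
    | add y z _ _ hy hz => rw [add_mul]; exact add_mem hy hz
    | smul c z _ hz => rw [smul_mul_assoc]; exact N.smul_mem c hz
  have mul_arc (a : Arc d) {z} (hz : z ∈ N) : z * uP K d a.1.1 a.1.2 ∈ N := by
    induction hz using Submodule.span_induction with
    | mem z hz =>
      obtain ⟨⟨e, m⟩, rfl⟩ := hz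
      refine Submodule.subset_span ⟨(e, a ::ₘ m), ?_⟩
      simp only [uMon_cons]
      ring
    | zero => simp
    | add y z _ _ hy hz => rw [add_mul]; exact add_mem hy hz
    | smul c z _ hz => rw [smul_mul_assoc]; exact N.smul_mem c hz
  have mul_u (p q : Fin d) {z} (hz : z ∈ N) : z * uP K d p q ∈ N := by
    rcases lt_trichotomy p q with h | rfl | h
    · exact mul_arc ⟨(p, q), h⟩ hz
    · simp [uP]
    · convert neg_mem (mul_arc ⟨(q, p), h⟩ hz) using 1
      simp only [uP]
      ring
  intro z hz
  suffices h : ∀ y ∈ N, y * z ∈ N by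
    simpa using h 1 (Submodule.subset_span ⟨(0, 0), by simp [xMon, uMon]⟩)
  replace hz : z ∈ constXY K d := hz
  induction hz using Algebra.adjoin_induction with
  | mem z hz =>
    rcases hz with ⟨i, rfl⟩ | ⟨⟨p, q⟩, rfl⟩
    · exact fun y hy => mul_x i hy
    · exact fun y hy => mul_u p q hy
  | algebraMap r =>
    intro y hy
    rw [mul_comm, ← Algebra.smul_def]
    exact N.smul_mem r hy
  | add f g _ _ hf hg => exact fun y hy => by rw [mul_add]; exact add_mem (hf y hy) (hg y hy)
  | mul f g _ _ hf hg => exact fun y hy => by rw [← mul_assoc]; exact hg _ (hf y hy)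

variable {δ : Derivation K (MvPolynomial (Var4 d) K) (MvPolynomial (Var4 d) K)}

theorem mul_mem_Lsub_s2 (hx : ∀ i : Fin d, δ (xP K d i) = 0)
    (hy : ∀ i : Fin d, δ (yP K d i) = xP K d i) {g z : MvPolynomial (Var4 d) K}
    (hg : g ∈ Lgens K d) (hz : z ∈ constXY K d) : g * z ∈ Lsub K d δ := by
  have h1 : constXY K d ≤ (embXY K d).range := by
    refine Algebra.adjoin_le ?_
    have hx' (i : Fin d) : xP K d i ∈ (embXY K d).range := ⟨X (.inl i), by simp [embXY, xP]⟩
    have hy' (i : Fin d) : yP K d i ∈ (embXY K d).range := ⟨X (.inr i), by simp [embXY, yP]⟩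
    rintro _ (⟨i, rfl⟩ | ⟨⟨p, q⟩, rfl⟩)
    · exact hx' i
    · exact sub_mem (mul_mem (hx' p) (hy' q)) (mul_mem (hx' q) (hy' p))
  have h2 : δ z = 0 := by
    induction hz using Algebra.adjoin_induction with
    | mem z hz =>
      rcases hz with ⟨i, rfl⟩ | ⟨⟨p, q⟩, rfl⟩
      · exact hx i
      · simp [uP, hx, hy, mul_comm]
    | algebraMap r => simp
    | add f g _ _ hf hg => simp [hf, hg]
    | mul f g _ _ hf hg => simp [hf, hg]
  obtain ⟨h, rfl⟩ := h1 hz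
  exact Submodule.subset_span ⟨g, hg, h, h2, rfl⟩

theorem aP_mul_mem (hx : ∀ i : Fin d, δ (xP K d i) = 0)
    (hy : ∀ i : Fin d, δ (yP K d i) = xP K d i) (i : Fin d) (e : Fin d →₀ ℕ)
    (m : Multiset (Arc d)) : aP K d i * xMon K d e * uMon K d m ∈
      Lsub K d δ ⊔ Submodule.span K (Fam1 K d ∪ Fam2 K d) := by
  induction hc : arcsCost m using Nat.strong_induction_on generalizing i e m with
  | _ c ih =>
  subst hc
  by_cases h1 : ∀ a ∈ m, ∀ b ∈ m, ¬(a.1.1 < b.1.1 ∧ b.1.1 < a.1.2 ∧ a.1.2 < b.1.2)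
  swap
  · push Not at h1
    obtain ⟨⟨⟨i₁, i₃⟩, h13⟩, ha, ⟨⟨i₂, i₄⟩, h24⟩, hb, h12, h23, h34⟩ := h1
    obtain ⟨m, rfl⟩ := Multiset.exists_cons_of_mem ha
    rw [Multiset.mem_cons, or_iff_right (by rintro ⟨⟩; exact lt_irrefl _ h12)] at hb
    obtain ⟨m, rfl⟩ := Multiset.exists_cons_of_mem hb
    dsimp only at *
    have key : aP K d i * xMon K d e * uMon K d (⟨(i₁, i₃), h13⟩ ::ₘ ⟨(i₂, i₄), h24⟩ ::ₘ m) =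
        aP K d i * xMon K d e * uMon K d (⟨(i₁, i₂), h12⟩ ::ₘ ⟨(i₃, i₄), h34⟩ ::ₘ m) +
        aP K d i * xMon K d e *
          uMon K d (⟨(i₁, i₄), h12.trans h24⟩ ::ₘ ⟨(i₂, i₃), h23⟩ ::ₘ m) := by
      simp only [uMon_cons, uP]
      ring
    have c1 := arcCost_lt (i := i₁) (k := i₃) h13 le_rfl h12 h23.le (.inr h23)
    have c2 := arcCost_lt (i := i₂) (k := i₄) h24 h23.le h34 le_rfl (.inl h23)
    have c3 := arcCost_add_lt h12 h23 h34
    rw [key]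
    exact add_mem (ih _ (by simp only [arcsCost_cons]; omega) _ _ _ rfl)
      (ih _ (by simp only [arcsCost_cons]; omega) _ _ _ rfl)
  by_cases h2 : ∀ a ∈ m, ∀ γ : Fin d, (γ = i ∨ e γ ≠ 0) → ¬(a.1.1 < γ ∧ γ < a.1.2)
  · exact Submodule.mem_sup_right (Submodule.subset_span (.inr ⟨i, e, m, h1, h2, rfl⟩))
  push Not at h2
  obtain ⟨⟨⟨p, q⟩, hpq⟩, ha, γ, hγ, hpγ, hγq⟩ := h2
  obtain ⟨m, rfl⟩ := Multiset.exists_cons_of_mem ha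
  dsimp only at *
  have c1 := arcCost_lt (i := p) (k := q) hpq le_rfl hpγ hγq.le (.inr hγq)
  have c2 := arcCost_lt (i := p) (k := q) hpq hpγ.le hγq le_rfl (.inl hpγ)
  rcases hγ with rfl | hγ
  · have key : aP K d γ * xMon K d e * uMon K d (⟨(p, q), hpq⟩ ::ₘ m) =
        aP K d p * xMon K d e * uMon K d (⟨(γ, q), hγq⟩ ::ₘ m) +
        aP K d q * xMon K d e * uMon K d (⟨(p, γ), hpγ⟩ ::ₘ m) -
        (aP K d p * uP K d γ q - aP K d γ * uP K d p q + aP K d q * uP K d p γ) *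
          (xMon K d e * uMon K d m) := by
      simp only [uMon_cons]
      ring
    rw [key]
    refine sub_mem (add_mem (ih _ ?_ _ _ _ rfl) (ih _ ?_ _ _ _ rfl)) (Submodule.mem_sup_left
      (mul_mem_Lsub_s2 hx hy (.inl (.inr ⟨p, γ, q, hpγ, hγq, rfl⟩))
        (mul_mem (xMon_mem_constXY e) (uMon_mem_constXY m))))
    all_goals simp only [arcsCost_cons]; omega
  · obtain ⟨e, rfl⟩ : ∃ e', e = e' + Finsupp.single γ 1 :=
      ⟨e - Finsupp.single γ 1, (tsub_add_cancel_of_le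
        (Finsupp.single_le_iff.mpr (Nat.one_le_iff_ne_zero.mpr hγ))).symm⟩
    have key : aP K d i * xMon K d (e + Finsupp.single γ 1) * uMon K d (⟨(p, q), hpq⟩ ::ₘ m) =
        aP K d i * xMon K d (e + Finsupp.single p 1) * uMon K d (⟨(γ, q), hγq⟩ ::ₘ m) +
        aP K d i * xMon K d (e + Finsupp.single q 1) * uMon K d (⟨(p, γ), hpγ⟩ ::ₘ m) := by
      simp only [uMon_cons, xMon_add_single, uP]
      ring
    rw [key]
    refine add_mem (ih _ ?_ _ _ _ rfl) (ih _ ?_ _ _ _ rfl)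
    all_goals simp only [arcsCost_cons]; omega

theorem wP_mul_uMon_mem (hx : ∀ i : Fin d, δ (xP K d i) = 0)
    (hy : ∀ i : Fin d, δ (yP K d i) = xP K d i) (a : Arc d) (m : Multiset (Arc d)) :
    wP K d a.1.1 a.1.2 * uMon K d m ∈
      Lsub K d δ ⊔ Submodule.span K (Fam1 K d ∪ Fam2 K d) := by
  induction hc : arcsCost (a ::ₘ m) using Nat.strong_induction_on generalizing a m with
  | _ c ih =>
  subst hc
  set T := Lsub K d δ ⊔ Submodule.span K (Fam1 K d ∪ Fam2 K d)
  have swap (a b : Arc d) (m : Multiset (Arc d))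
      (h : wP K d b.1.1 b.1.2 * uMon K d (a ::ₘ m) ∈ T) :
      wP K d a.1.1 a.1.2 * uMon K d (b ::ₘ m) ∈ T := by
    have key : wP K d a.1.1 a.1.2 * uMon K d (b ::ₘ m) = wP K d b.1.1 b.1.2 * uMon K d (a ::ₘ m) +
        (wP K d a.1.1 a.1.2 * uP K d b.1.1 b.1.2 - wP K d b.1.1 b.1.2 * uP K d a.1.1 a.1.2) *
          uMon K d m := by
      simp only [uMon_cons]
      ring
    rw [key]
    exact add_mem h (Submodule.mem_sup_left (mul_mem_Lsub_s2 hx hy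
      (.inr ⟨_, _, _, _, a.2, b.2, rfl⟩) (uMon_mem_constXY m)))
  by_cases h1 : ∀ b ∈ a ::ₘ m, ∀ c ∈ a ::ₘ m,
      ¬(b.1.1 < c.1.1 ∧ c.1.1 < b.1.2 ∧ b.1.2 < c.1.2)
  · exact Submodule.mem_sup_right (Submodule.subset_span (.inl ⟨a, m, h1, rfl⟩))
  push Not at h1
  obtain ⟨b, hb, c, hc, h12, h23, h34⟩ := h1
  have hbc : c ≠ b := by rintro rfl; exact lt_irrefl _ h12
  obtain ⟨m', hm'⟩ := Multiset.exists_cons_of_mem hb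
  rw [hm', Multiset.mem_cons, or_iff_right hbc] at hc
  obtain ⟨m'', rfl⟩ := Multiset.exists_cons_of_mem hc
  -- It suffices to treat the case where the crossing arc `b` carries the factor `w`.
  suffices h : wP K d b.1.1 b.1.2 * uMon K d (c ::ₘ m'') ∈ T by
    by_cases hab : a = b
    · subst hab
      rwa [(Multiset.cons_inj_right a).mp hm']
    · obtain ⟨m₁, hm₁⟩ := Multiset.exists_cons_of_mem
        ((Multiset.mem_cons.mp (hm' ▸ Multiset.mem_cons_self a m)).resolve_left hab)
      rw [hm₁, Multiset.cons_swap, Multiset.cons_inj_right] at hm'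
      rw [hm']
      exact swap a b m₁ (hm₁ ▸ h)
  rw [hm'] at ih
  obtain ⟨⟨i₁, i₃⟩, h13⟩ := b
  obtain ⟨⟨i₂, i₄⟩, h24⟩ := c
  dsimp only at *
  have key : wP K d i₁ i₃ * uMon K d (⟨(i₂, i₄), h24⟩ ::ₘ m'') =
      wP K d i₁ i₂ * uMon K d (⟨(i₃, i₄), h34⟩ ::ₘ m'') +
      wP K d i₁ i₄ * uMon K d (⟨(i₂, i₃), h23⟩ ::ₘ m'') := by
    simp only [uMon_cons, uP, wP]
    ring
  have c1 := arcCost_lt (i := i₁) (k := i₃) h13 le_rfl h12 h23.le (.inr h23)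
  have c2 := arcCost_lt (i := i₂) (k := i₄) h24 h23.le h34 le_rfl (.inl h23)
  have c3 := arcCost_add_lt h12 h23 h34
  rw [key]
  exact add_mem (ih _ (by simp only [arcsCost_cons]; omega) ⟨(i₁, i₂), h12⟩ _ rfl)
    (ih _ (by simp only [arcsCost_cons]; omega) ⟨(i₁, i₄), h12.trans h24⟩ _ rfl)

theorem wP_arc_mul_mem (hx : ∀ i : Fin d, δ (xP K d i) = 0)
    (hy : ∀ i : Fin d, δ (yP K d i) = xP K d i) (a : Arc d) (e : Fin d →₀ ℕ)
    (m : Multiset (Arc d)) : wP K d a.1.1 a.1.2 * xMon K d e * uMon K d m ∈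
      Lsub K d δ ⊔ Submodule.span K (Fam1 K d ∪ Fam2 K d) := by
  by_cases he : e = 0
  · simpa [he, xMon] using wP_mul_uMon_mem hx hy a m
  obtain ⟨γ, hγ⟩ := Finsupp.ne_iff.mp he
  obtain ⟨e, rfl⟩ : ∃ e', e = e' + Finsupp.single γ 1 :=
    ⟨e - Finsupp.single γ 1, (tsub_add_cancel_of_le
      (Finsupp.single_le_iff.mpr (Nat.one_le_iff_ne_zero.mpr hγ))).symm⟩
  have key : wP K d a.1.1 a.1.2 * xMon K d (e + Finsupp.single γ 1) * uMon K d m =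
      aP K d γ * xMon K d e * uMon K d (a ::ₘ m) -
      (aP K d γ * uP K d a.1.1 a.1.2 - wP K d a.1.1 a.1.2 * xP K d γ) *
        (xMon K d e * uMon K d m) := by
    simp only [uMon_cons, xMon_add_single]
    ring
  rw [key]
  exact sub_mem (aP_mul_mem hx hy _ _ _) (Submodule.mem_sup_left (mul_mem_Lsub_s2 hx hy
    (.inl (.inl (.inr ⟨γ, _, _, a.2, rfl⟩))) (mul_mem (xMon_mem_constXY e) (uMon_mem_constXY m))))

theorem wP_mul_mem_s2 (hx : ∀ i : Fin d, δ (xP K d i) = 0)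
    (hy : ∀ i : Fin d, δ (yP K d i) = xP K d i) (p q : Fin d) (e : Fin d →₀ ℕ)
    (m : Multiset (Arc d)) : wP K d p q * xMon K d e * uMon K d m ∈
      Lsub K d δ ⊔ Submodule.span K (Fam1 K d ∪ Fam2 K d) := by
  have hem := mul_mem (xMon_mem_constXY (K := K) e) (uMon_mem_constXY m)
  rcases lt_trichotomy p q with h | rfl | h
  · exact wP_arc_mul_mem hx hy ⟨(p, q), h⟩ e m
  · rw [mul_assoc]
    exact Submodule.mem_sup_left (mul_mem_Lsub_s2 hx hy
      (.inl (.inl (.inl (.inl (.inl ⟨p, rfl⟩))))) hem)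
  · have key : wP K d p q * xMon K d e * uMon K d m =
        (wP K d q p + wP K d p q) * (xMon K d e * uMon K d m) -
          wP K d q p * xMon K d e * uMon K d m := by ring
    rw [key]
    exact sub_mem (Submodule.mem_sup_left (mul_mem_Lsub_s2 hx hy
      (.inl (.inl (.inl (.inl (.inr ⟨q, p, h, rfl⟩))))) hem)) (wP_arc_mul_mem hx hy ⟨(q, p), h⟩ e m)

theorem mem_of_mem_constAB (hx : ∀ i : Fin d, δ (xP K d i) = 0)
    (hy : ∀ i : Fin d, δ (yP K d i) = xP K d i) {f : MvPolynomial (Var4 d) K}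
    (hf : f ∈ constAB K d) : f ∈ Lsub K d δ ⊔ Submodule.span K (Fam1 K d ∪ Fam2 K d) := by
  set T := Lsub K d δ ⊔ Submodule.span K (Fam1 K d ∪ Fam2 K d)
  have mul_mem_of {g z : MvPolynomial (Var4 d) K}
      (hg : ∀ e m, g * xMon K d e * uMon K d m ∈ T) (hz : z ∈ constXY K d) : z * g ∈ T := by
    replace hz := constXY_le_span hz
    induction hz using Submodule.span_induction with
    | mem z hz =>
      obtain ⟨⟨e, m⟩, rfl⟩ := hz
      rw [mul_comm, ← mul_assoc]
      exact hg e m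
    | zero => simp
    | add y z _ _ hy hz => rw [add_mul]; exact add_mem hy hz
    | smul c z _ hz => rw [smul_mul_assoc]; exact T.smul_mem c hz
  induction hf using Submodule.closure_induction with
  | zero => exact zero_mem _
  | add f g _ _ hf hg => exact add_mem hf hg
  | smul_mem z g hg =>
    rcases hg with ⟨i, rfl⟩ | ⟨⟨p, q⟩, rfl⟩
    · exact mul_mem_of (aP_mul_mem hx hy i) z.2
    · exact mul_mem_of (wP_mul_mem_s2 hx hy p q) z.2

end Straightening

/-- Every constant of `δ` in `C_{2d}` is, modulo the submodule `L`, a `K`-linear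
combination of the canonical elements `w_{p₀q₀}·u_{p₁q₁}⋯u_{p_r q_r}` and
`a_{i₀}·x_{i₁}⋯x_{i_m}·u_{k₁l₁}⋯u_{k_s l_s}`. -/
theorem constants_spanned_mod_L (K : Type*) [Field K] [CharZero K] (d : ℕ) (hd : 2 ≤ d)
    (δ : Derivation K (MvPolynomial (Var4 d) K) (MvPolynomial (Var4 d) K))
    (ha : ∀ i : Fin d, δ (aP K d i) = 0)
    (hb : ∀ i : Fin d, δ (bP K d i) = aP K d i)
    (hx : ∀ i : Fin d, δ (xP K d i) = 0)
    (hy : ∀ i : Fin d, δ (yP K d i) = xP K d i)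
    (f : MvPolynomial (Var4 d) K) (hf : f ∈ Cmod K d) (hδf : δ f = 0) :
    ∃ g ∈ Lsub K d δ, f - g ∈ Submodule.span K (Fam1 K d ∪ Fam2 K d) := by
  have h := mem_of_mem_constAB hx hy (mem_constAB hf (eq_polarization ha hb hx hy ▸ hδf))
  obtain ⟨g, hg, s, hs, rfl⟩ := Submodule.mem_sup.mp h
  exact ⟨g, hg, by rwa [add_sub_cancel_left]⟩

end
end
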